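/- Let R be a graded-commutative noetherian ring and let R^0 be its subring of homogeneous elements of degree 0. Suppose that every homogeneous element a ∈ R with |a| ≠ 0 is nilpotent. Let T be an R-linear triangulated category, regarded also as an R^0-linear triangulated category by restricting the R-action along the inclusion R^0 → R. Then T is stratified (resp., costratified) by the action of R if and only if T is stratified (resp., costratified) by the action of R^0. -/

import Mathlib

open CategoryTheory Limits Pretriangulated MonoidalCategory

namespace Paper

universe v u w

variable (C : Type u) [Category.{v} C] [HasZeroObject C] [Preadditive C]
  [HasShift C ℤ] [∀ n : ℤ, (shiftFunctor C n).Additive] [Pretriangulated C]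

/-- A localizing subcategory: a replete, triangulated, retract-closed subcategory
closed under arbitrary (small) coproducts, encoded as a set of objects. -/
structure IsLocalizing (S : Set C) : Prop where
  iso_mem : ∀ {X Y : C}, (X ≅ Y) → X ∈ S → Y ∈ S
  zero_mem : ∀ {X : C}, IsZero X → X ∈ S
  shift_mem : ∀ (X : C) (n : ℤ), X ∈ S → (X⟦n⟧ ∈ S)
  ext_mem : ∀ (T : Triangle C), (T ∈ distTriang C) → T.obj₁ ∈ S → T.obj₃ ∈ S → T.obj₂ ∈ S
  retract_mem : ∀ (X Y : C) (i : X ⟶ Y) (r : Y ⟶ X), i ≫ r = 𝟙 X → Y ∈ S → X ∈ S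
  coprod_mem : ∀ {ι : Type v} (f : ι → C) [HasCoproduct f], (∀ i, f i ∈ S) → (∐ f) ∈ S

/-- A colocalizing subcategory: thick and closed under arbitrary (small) products. -/
structure IsColocalizing (S : Set C) : Prop where
  iso_mem : ∀ {X Y : C}, (X ≅ Y) → X ∈ S → Y ∈ S
  zero_mem : ∀ {X : C}, IsZero X → X ∈ S
  shift_mem : ∀ (X : C) (n : ℤ), X ∈ S → (X⟦n⟧ ∈ S)
  ext_mem : ∀ (T : Triangle C), (T ∈ distTriang C) → T.obj₁ ∈ S → T.obj₃ ∈ S → T.obj₂ ∈ S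
  retract_mem : ∀ (X Y : C) (i : X ⟶ Y) (r : Y ⟶ X), i ≫ r = 𝟙 X → Y ∈ S → X ∈ S
  prod_mem : ∀ {ι : Type v} (f : ι → C) [HasProduct f], (∀ i, f i ∈ S) → (∏ᶜ f) ∈ S

/-- A thick subcategory: a replete triangulated subcategory closed under retracts. -/
structure IsThick (S : Set C) : Prop where
  iso_mem : ∀ {X Y : C}, (X ≅ Y) → X ∈ S → Y ∈ S
  zero_mem : ∀ {X : C}, IsZero X → X ∈ S
  shift_mem : ∀ (X : C) (n : ℤ), X ∈ S → (X⟦n⟧ ∈ S)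
  ext_mem : ∀ (T : Triangle C), (T ∈ distTriang C) → T.obj₁ ∈ S → T.obj₃ ∈ S → T.obj₂ ∈ S
  retract_mem : ∀ (X Y : C) (i : X ⟶ Y) (r : Y ⟶ X), i ≫ r = 𝟙 X → Y ∈ S → X ∈ S

/-- `Loc_C(E)`: the smallest localizing subcategory containing `E`. -/
def Loc (E : Set C) : Set C := ⋂₀ {S : Set C | IsLocalizing C S ∧ E ⊆ S}

/-- `Coloc_C(E)`: the smallest colocalizing subcategory containing `E`. -/
def Coloc (E : Set C) : Set C := ⋂₀ {S : Set C | IsColocalizing C S ∧ E ⊆ S}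

/-- `Thick_C(E)`: the smallest thick subcategory containing `E`. -/
def Thick (E : Set C) : Set C := ⋂₀ {S : Set C | IsThick C S ∧ E ⊆ S}

/-- `X` builds `Y` if `Y ∈ Loc(X)`. -/
def Builds (X Y : C) : Prop := Y ∈ Loc C {X}

/-- `X` finitely builds `Y` if `Y ∈ Thick(X)`. -/
def FinitelyBuilds (X Y : C) : Prop := Y ∈ Thick C {X}

/-- `X` cobuilds `Y` if `Y ∈ Coloc(X)`. -/
def Cobuilds (X Y : C) : Prop := Y ∈ Coloc C {X}

/-- The canonical map `⊕ᵢ Hom(X, fᵢ) → Hom(X, ∐ f)`. -/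
noncomputable def coproductComparison {ι : Type v} (X : C) (f : ι → C) [HasCoproduct f] :
    DirectSum ι (fun i => (X ⟶ f i)) →+ (X ⟶ ∐ f) :=
  letI := Classical.decEq ι
  DirectSum.toAddMonoid fun i =>
    { toFun := fun g => g ≫ Sigma.ι f i
      map_zero' := by simp
      map_add' := fun g h => by simp [Preadditive.add_comp] }

/-- An object `X` is compact (small) if the natural map
`⊕ᵢ Hom(X, Aᵢ) → Hom(X, ∐ᵢ Aᵢ)` is an isomorphism for every set-indexed family. -/
def IsCompactObj (X : C) : Prop :=
  ∀ {ι : Type v} (f : ι → C) [HasCoproduct f], Function.Bijective (coproductComparison C X f)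

/-- A nonzero object `X` is proxy-small if there is a compact witness `W` such that
`X` finitely builds `W` and `W` builds `X`. -/
def IsProxySmall (X : C) : Prop :=
  ¬ IsZero X ∧ ∃ W : C, IsCompactObj C W ∧ FinitelyBuilds C X W ∧ Builds C W X

/-- A nonzero object `X` is virtually small if there is a nonzero compact `W`
finitely built from `X`. -/
def IsVirtuallySmall (X : C) : Prop :=
  ¬ IsZero X ∧ ∃ W : C, ¬ IsZero W ∧ IsCompactObj C W ∧ FinitelyBuilds C X W

/-- A subset of a poset (e.g. of `Spec R`) is specialization closed if it is
closed upwards. -/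
def SpecializationClosed {P : Type w} [PartialOrder P] (V : Set P) : Prop :=
  ∀ ⦃p q : P⦄, p ∈ V → p ≤ q → q ∈ V

theorem specializationClosed_up {P : Type w} [PartialOrder P] (p : P) :
    SpecializationClosed {q : P | p ≤ q} :=
  fun _ _ hq hqr => le_trans hq hqr

theorem specializationClosed_notDown {P : Type w} [PartialOrder P] (p : P) :
    SpecializationClosed {q : P | ¬ q ≤ p} :=
  fun _ _ hq hqr h => hq (le_trans hqr h)

/-- The package of Benson-Iyengar-Krause local (co)homology functors on a triangulated
category, indexed by the specialization closed subsets of a spectrum `P`: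
`gam V` is the torsion (colocalization) functor `Γ_V`, `loc V` is the localization
functor `L_{V^c}`, and `lam V = Λ^V`, `vee V = V_{V^c}` are their respective right
adjoints.  For each `X` there is a distinguished localization triangle
`Γ_V X ⟶ X ⟶ L_{V^c} X ⟶ (Γ_V X)[1]`, objects of the form `Γ_V X` are
`L_{V^c}`-acyclic, and objects of the form `L_{V^c} Y` are `L_{V^c}`-local. -/
structure BIKPackage (P : Type w) [PartialOrder P] where
  gam : ∀ (V : Set P), SpecializationClosed V → C ⥤ C
  loc : ∀ (V : Set P), SpecializationClosed V → C ⥤ C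
  lam : ∀ (V : Set P), SpecializationClosed V → C ⥤ C
  vee : ∀ (V : Set P), SpecializationClosed V → C ⥤ C
  gamToId : ∀ V hV, gam V hV ⟶ 𝟭 C
  idToLoc : ∀ V hV, 𝟭 C ⟶ loc V hV
  conn : ∀ V hV (X : C), (loc V hV).obj X ⟶ ((gam V hV).obj X)⟦(1 : ℤ)⟧
  triangle_dist : ∀ V hV (X : C),
    Triangle.mk ((gamToId V hV).app X) ((idToLoc V hV).app X) (conn V hV X) ∈ distTriang C
  gam_adj : ∀ V hV, gam V hV ⊣ lam V hV
  loc_adj : ∀ V hV, loc V hV ⊣ vee V hV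
  gam_acyclic : ∀ V hV (X : C), IsZero ((loc V hV).obj ((gam V hV).obj X))
  loc_local : ∀ V hV (X Y : C), IsZero ((loc V hV).obj X) →
    ∀ g : X ⟶ (loc V hV).obj Y, g = 0

/-- The essential image of an endofunctor, as a set of objects. -/
def essImageSet (F : C ⥤ C) : Set C := {Y : C | ∃ X : C, Nonempty (F.obj X ≅ Y)}

/-- A minimal localizing subcategory: a nonzero localizing subcategory with
no proper nonzero localizing subcategory. -/
def IsMinimalLocalizing (S : Set C) : Prop :=
  IsLocalizing C S ∧ (∃ X ∈ S, ¬ IsZero X) ∧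
    ∀ S' : Set C, IsLocalizing C S' → S' ⊆ S → (∃ X ∈ S', ¬ IsZero X) → S' = S

/-- A minimal colocalizing subcategory. -/
def IsMinimalColocalizing (S : Set C) : Prop :=
  IsColocalizing C S ∧ (∃ X ∈ S, ¬ IsZero X) ∧
    ∀ S' : Set C, IsColocalizing C S' → S' ⊆ S → (∃ X ∈ S', ¬ IsZero X) → S' = S

namespace BIKPackage

variable {C} {P : Type w} [PartialOrder P] (B : BIKPackage C P)

/-- The composite functor `Γ_p L_p` (denoted `Γ_p` in BIK). -/
def gl (p : P) : C ⥤ C :=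
  B.loc {q : P | ¬ q ≤ p} (specializationClosed_notDown p) ⋙
    B.gam {q : P | p ≤ q} (specializationClosed_up p)

/-- The composite functor `Λ^p V_p` (denoted `Λ^p` in BIK). -/
def lv (p : P) : C ⥤ C :=
  B.vee {q : P | ¬ q ≤ p} (specializationClosed_notDown p) ⋙
    B.lam {q : P | p ≤ q} (specializationClosed_up p)

/-- The (small) support `supp(X) = { p | Γ_p L_p X ≠ 0 }`. -/
def supp (X : C) : Set P := {p : P | ¬ IsZero ((B.gl p).obj X)}

/-- The cosupport `cosupp(X) = { p | Λ^p V_p X ≠ 0 }`. -/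
def cosupp (X : C) : Set P := {p : P | ¬ IsZero ((B.lv p).obj X)}

/-- The category is stratified: the local-to-global principle holds, and each
`Γ_p L_p C` is either zero or a minimal localizing subcategory. -/
def Stratified : Prop :=
  (∀ X : C, Loc C {X} = Loc C (Set.range fun p : P => (B.gl p).obj X)) ∧
  ∀ p : P, (∀ Y ∈ essImageSet C (B.gl p), IsZero Y) ∨ IsMinimalLocalizing C (essImageSet C (B.gl p))

/-- The category is costratified: the colocalizing local-to-global principle holds,
and each `Λ^p V_p C` is either zero or a minimal colocalizing subcategory. -/
def Costratified : Prop :=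
  (∀ X : C, Coloc C {X} = Coloc C (Set.range fun p : P => (B.lv p).obj X)) ∧
  ∀ p : P, (∀ Y ∈ essImageSet C (B.lv p), IsZero Y) ∨
    IsMinimalColocalizing C (essImageSet C (B.lv p))

end BIKPackage

/-- A (ℤ-)graded-commutative noetherian ring: a ring `R` together with an internal
ℤ-grading such that homogeneous elements satisfy `a * b = (-1)^{|a||b|} b * a`,
and `R` is noetherian. -/
structure GradedCommNoethRing (R : Type) [Ring R] where
  deg : ℤ → AddSubgroup R
  one_mem : (1 : R) ∈ deg 0
  mul_mem : ∀ {m n : ℤ} {a b : R}, a ∈ deg m → b ∈ deg n → a * b ∈ deg (m + n)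
  internal : DirectSum.IsInternal fun n => deg n
  gcomm : ∀ {m n : ℤ} {a b : R}, a ∈ deg m → b ∈ deg n →
    a * b = (if Even (m * n) then b * a else -(b * a))
  noeth : IsNoetherianRing R

variable {R : Type} [Ring R]

/-- An ideal is homogeneous if it is generated by its homogeneous elements. -/
def GradedCommNoethRing.IsHomogeneous (G : GradedCommNoethRing R) (I : Ideal R) : Prop :=
  I = Ideal.span {a : R | a ∈ I ∧ ∃ n : ℤ, a ∈ G.deg n}

/-- `Spec R`: the homogeneous prime spectrum of a graded-commutative ring,
partially ordered by inclusion. -/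
def SpecG (G : GradedCommNoethRing R) : Type :=
  {I : Ideal R // I.IsPrime ∧ G.IsHomogeneous I}

instance (G : GradedCommNoethRing R) : PartialOrder (SpecG G) :=
  Subtype.partialOrder _

section Monoidal

variable (C : Type u) [Category.{v} C] [HasZeroObject C] [Preadditive C]
  [HasShift C ℤ] [∀ n : ℤ, (shiftFunctor C n).Additive] [Pretriangulated C]
  [MonoidalCategory C] [SymmetricCategory C] [MonoidalClosed C]

/-- The tensor-triangulated category is rigidly-compactly generated by its tensor
unit: `𝟙` is a compact (and automatically dualizable) generator. -/
def UnitRigidlyCompactlyGenerates : Prop :=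
  IsCompactObj C (𝟙_ C) ∧ Loc C {(𝟙_ C)} = Set.univ

/-- A canonical action of the graded-commutative ring `R` on a tensor-triangulated
category, i.e. an action which factors through the graded endomorphism ring
`End*(𝟙)` of the tensor unit: it is the data of a homomorphism of graded rings
`R → End*(𝟙)`. -/
structure CanonicalUnitAction (G : GradedCommNoethRing R) where
  u : ∀ n : ℤ, G.deg n → ((𝟙_ C) ⟶ (𝟙_ C)⟦n⟧)
  u_add : ∀ (n : ℤ) (r s : G.deg n), u n (r + s) = u n r + u n s
  u_one : u 0 ⟨1, G.one_mem⟩ = (shiftFunctorZero C ℤ).inv.app (𝟙_ C)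
  u_mul : ∀ {m n : ℤ} (r : G.deg m) (s : G.deg n),
    u (m + n) ⟨(r : R) * (s : R), G.mul_mem r.2 s.2⟩ =
      u m r ≫ (u n s)⟦(m : ℤ)⟧' ≫
        (shiftFunctorAdd' C n m (m + n) (add_comm n m)).inv.app (𝟙_ C)

/-- `End*(𝟙)` is a finitely generated `R`-module (the "noetherian" condition of
Benson–Iyengar–Krause): there is a finite set of homogeneous elements of `End*(𝟙)`
generating it over `R` via the canonical action. -/
def EndUnitFG {G : GradedCommNoethRing R} (uC : CanonicalUnitAction C G) : Prop :=
  ∃ s : Finset (Σ n : ℤ, ((𝟙_ C) ⟶ (𝟙_ C)⟦n⟧)),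
    ∀ (m : ℤ) (h : (𝟙_ C) ⟶ (𝟙_ C)⟦m⟧),
      ∃ c : ∀ _x : (Σ n : ℤ, ((𝟙_ C) ⟶ (𝟙_ C)⟦n⟧)), G.deg (m - _x.1),
        h = ∑ x ∈ s, uC.u (m - x.1) (c x) ≫ ((x.2)⟦(m - x.1 : ℤ)⟧') ≫
          (shiftFunctorAdd' C x.1 (m - x.1) m (by omega)).inv.app (𝟙_ C)

/-- The smashing/co-smashing properties of the BIK functors which hold when the
`R`-action is canonical: `Γ_V` and `L_{V^c}` are smashing. -/
structure MonoidalBIKPackage (P : Type w) [PartialOrder P] extends BIKPackage C P where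
  gam_smash : ∀ V hV (X : C), Nonempty ((gam V hV).obj X ≅ (gam V hV).obj (𝟙_ C) ⊗ X)
  loc_smash : ∀ V hV (X : C), Nonempty ((loc V hV).obj X ≅ (loc V hV).obj (𝟙_ C) ⊗ X)

variable (D : Type u) [Category.{v} D] [HasZeroObject D] [Preadditive D]
  [HasShift D ℤ] [∀ n : ℤ, (shiftFunctor D n).Additive] [Pretriangulated D]
  [MonoidalCategory D] [SymmetricCategory D] [MonoidalClosed D]

/-- A strong (symmetric) monoidal exact functor `F` is a canonical `R`-linear functor
if it intertwines the canonical actions of `R` on the two categories, via the unit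
isomorphism `𝟙_D ≅ F(𝟙_C)` and the shift-commutation isomorphism of `F`. -/
def IsCanonicalRLinear {G : GradedCommNoethRing R} (F : C ⥤ D) [F.Monoidal]
    [F.CommShift ℤ] (uC : CanonicalUnitAction C G) (uD : CanonicalUnitAction D G) : Prop :=
  ∀ (n : ℤ) (r : G.deg n),
    uD.u n r = (Functor.Monoidal.εIso F).hom ≫ F.map (uC.u n r) ≫
      (F.commShiftIso n).hom.app (𝟙_ C) ≫ ((Functor.Monoidal.εIso F).inv)⟦(n : ℤ)⟧'

/-- Compatibility of the BIK functors with the functors `f^* ⊣ f_* ⊣ f^{(1)}`: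
for an `R`-linear functor the torsion and localization functors commute with `f^*`
and `f_*`, and the completion and colocalization functors commute with `f_*` and
`f^{(1)}` (Benson–Iyengar–Krause, and Lemma 2.7 of the paper). -/
structure BIKCompat {P : Type w} [PartialOrder P] (BT : BIKPackage C P) (BU : BIKPackage D P)
    (F : C ⥤ D) (Fdown : D ⥤ C) (Fup : C ⥤ D) where
  gam_pull : ∀ V hV, BT.gam V hV ⋙ F ≅ F ⋙ BU.gam V hV
  loc_pull : ∀ V hV, BT.loc V hV ⋙ F ≅ F ⋙ BU.loc V hV
  gam_push : ∀ V hV, BU.gam V hV ⋙ Fdown ≅ Fdown ⋙ BT.gam V hV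
  loc_push : ∀ V hV, BU.loc V hV ⋙ Fdown ≅ Fdown ⋙ BT.loc V hV
  lam_push : ∀ V hV, BU.lam V hV ⋙ Fdown ≅ Fdown ⋙ BT.lam V hV
  vee_push : ∀ V hV, BU.vee V hV ⋙ Fdown ≅ Fdown ⋙ BT.vee V hV
  lam_up : ∀ V hV, BT.lam V hV ⋙ Fup ≅ Fup ⋙ BU.lam V hV
  vee_up : ∀ V hV, BT.vee V hV ⋙ Fup ≅ Fup ⋙ BU.vee V hV

end Monoidal

/-- The subring of homogeneous elements of degree `0` of a graded-commutative ring. -/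
def GradedCommNoethRing.degZeroSubring {R : Type} [Ring R] (G : GradedCommNoethRing R) :
    Subring R where
  carrier := G.deg 0
  one_mem' := G.one_mem
  mul_mem' := fun {a b} ha hb => by simpa using G.mul_mem ha hb
  add_mem' := fun {a b} ha hb => (G.deg 0).add_mem ha hb
  zero_mem' := (G.deg 0).zero_mem
  neg_mem' := fun {a} ha => (G.deg 0).neg_mem ha

/-- The degree-zero subring `R^0` of a graded-commutative ring is commutative. -/
instance {R : Type} [Ring R] (G : GradedCommNoethRing R) : CommRing G.degZeroSubring :=
  { (inferInstance : Ring G.degZeroSubring) with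
    mul_comm := fun a b => Subtype.ext (by simpa using G.gcomm a.2 b.2) }

/-- The ordinary prime spectrum of a (commutative) ring, ordered by inclusion. -/
def Spec0 (S : Type) [CommRing S] : Type := {I : Ideal S // I.IsPrime}

instance (S : Type) [CommRing S] : PartialOrder (Spec0 S) := Subtype.partialOrder _

section Actions

variable (C : Type u) [Category.{v} C] [HasZeroObject C] [Preadditive C]
  [HasShift C ℤ] [∀ n : ℤ, (shiftFunctor C n).Additive] [Pretriangulated C]

variable {R : Type} [Ring R]

/-- An action of the graded-commutative ring `R` on a triangulated category:
for each object `X` a homomorphism `φ_X` from `R` to the graded endomorphism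
ring `End*(X)`, compatible with the left and right actions on graded Homs. -/
structure RAction (G : GradedCommNoethRing R) where
  act : ∀ (X : C) (n : ℤ), G.deg n → (X ⟶ X⟦n⟧)
  act_add : ∀ (X : C) (n : ℤ) (r s : G.deg n), act X n (r + s) = act X n r + act X n s
  act_one : ∀ X : C, act X 0 ⟨1, G.one_mem⟩ = (shiftFunctorZero C ℤ).inv.app X
  act_mul : ∀ (X : C) {m n : ℤ} (r : G.deg m) (s : G.deg n),
    act X (m + n) ⟨(r : R) * (s : R), G.mul_mem r.2 s.2⟩ =
      act X m r ≫ (act X n s)⟦(m : ℤ)⟧' ≫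
        (shiftFunctorAdd' C n m (m + n) (add_comm n m)).inv.app X
  act_central : ∀ {X Y : C} (f : X ⟶ Y) (n : ℤ) (r : G.deg n),
    f ≫ act Y n r = act X n r ≫ f⟦(n : ℤ)⟧'

/-- The restriction of an `R`-action to the degree-zero subring `R^0`, acting
through degree-zero endomorphisms. -/
def RAction.restrictDegZero {G : GradedCommNoethRing R} (A : RAction C G)
    (X : C) (s : G.degZeroSubring) : X ⟶ X :=
  A.act X 0 ⟨s.1, s.2⟩ ≫ (shiftFunctorZero C ℤ).hom.app X

/-- The BIK package for the action of a graded-commutative ring `R`, together with the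
defining property of the localization functors: `L_{V^c} X = 0` if and only if the
localization of the graded module `Hom*(W, X)` at every homogeneous prime `p ∉ V`
vanishes, for every compact `W`. -/
structure CharBIKPackage (G : GradedCommNoethRing R) (A : RAction C G)
    extends BIKPackage C (SpecG G) where
  ker_char : ∀ V hV (X : C),
    IsZero ((loc V hV).obj X) ↔
      ∀ p : SpecG G, p ∉ V → ∀ (W : C), IsCompactObj C W → ∀ (n : ℤ) (g : W ⟶ X⟦n⟧),
        ∃ (d : ℤ) (s : G.deg d), (s : R) ∉ p.1 ∧ g ≫ (A.act X d s)⟦(n : ℤ)⟧' = 0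

/-- The BIK package for the (degree-zero) action of an ordinary commutative ring `S`,
with the defining property of the localization functors. -/
structure CharBIKPackage0 (S : Type) [CommRing S] (act0 : ∀ X : C, S → (X ⟶ X))
    extends BIKPackage C (Spec0 S) where
  ker_char : ∀ V hV (X : C),
    IsZero ((loc V hV).obj X) ↔
      ∀ q : Spec0 S, q ∉ V → ∀ (W : C), IsCompactObj C W → ∀ (n : ℤ) (g : W ⟶ X⟦n⟧),
        ∃ s : S, s ∉ q.1 ∧ g ≫ (act0 X s)⟦(n : ℤ)⟧' = 0

end Actions

set_option linter.unusedSectionVars false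

section
variable {R : Type} [Ring R] (G : GradedCommNoethRing R)

namespace GradedCommNoethRing

theorem isNilpotent_mul {m : ℤ} {a b : R} (ha : a ∈ G.deg m) (hb : b ∈ G.deg (-m))
    (hnil : IsNilpotent a) : IsNilpotent (a * b) := by
  have hab : a * b ∈ G.deg 0 := by simpa using G.mul_mem ha hb
  have hcomm : Commute (a * b) a := by
    have := G.gcomm hab ha
    rwa [zero_mul, if_pos Even.zero] at this
  obtain ⟨e, he⟩ : ∃ e : R, a * b = e * a := by
    rw [G.gcomm ha hb]
    split_ifs
    · exact ⟨b, rfl⟩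
    · exact ⟨-b, by simp⟩
  have key : ∀ k : ℕ, ∃ c : R, (a * b) ^ k = c * a ^ k := by
    intro k
    induction k with
    | zero => exact ⟨1, by simp⟩
    | succ k ih =>
      obtain ⟨c, hc⟩ := ih
      refine ⟨c * e, ?_⟩
      rw [pow_succ, hc, mul_assoc, ← (hcomm.pow_right k).eq, he, pow_succ', mul_assoc, mul_assoc]
  obtain ⟨k, hk⟩ := hnil
  obtain ⟨c, hc⟩ := key k
  exact ⟨k, by rw [hc, hk, mul_zero]⟩

/-- The chosen decomposition of a graded-commutative ring into homogeneous components. -/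
@[reducible] noncomputable def decomposition : DirectSum.Decomposition G.deg :=
  G.internal.chooseDecomposition

/-- The degree-zero component of an element. -/
noncomputable def degZeroPart : R →+ G.degZeroSubring :=
  letI := G.decomposition
  { toFun := fun x => ⟨(DirectSum.decompose G.deg x 0 : R), (DirectSum.decompose G.deg x 0).2⟩
    map_zero' := by simp
    map_add' := fun x y => by
      apply Subtype.ext
      simp [DirectSum.decompose_add] }

theorem degZeroPart_of_mem {a : R} (ha : a ∈ G.deg 0) : G.degZeroPart a = ⟨a, ha⟩ :=
  letI := G.decomposition
  Subtype.ext (DirectSum.decompose_of_mem_same G.deg ha)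

theorem degZeroPart_of_mem_ne {n : ℤ} (hn : n ≠ 0) {a : R} (ha : a ∈ G.deg n) :
    G.degZeroPart a = 0 :=
  letI := G.decomposition
  Subtype.ext (DirectSum.decompose_of_mem_ne G.deg ha hn)

theorem homogeneous_induction {motive : R → Prop} (zero : motive 0)
    (homogeneous : ∀ (n : ℤ) (a : R), a ∈ G.deg n → motive a)
    (add : ∀ a b : R, motive a → motive b → motive (a + b)) (x : R) : motive x :=
  letI := G.decomposition
  DirectSum.Decomposition.inductionOn G.deg zero (fun m => homogeneous _ m.1 m.2) add x

theorem mk_degZeroPart_mul (hnil : ∀ n : ℤ, n ≠ 0 → ∀ a ∈ G.deg n, IsNilpotent a)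
    (q : Ideal G.degZeroSubring) (hq : q.IsPrime) (x y : R) :
    Ideal.Quotient.mk q (G.degZeroPart (x * y)) =
      Ideal.Quotient.mk q (G.degZeroPart x) * Ideal.Quotient.mk q (G.degZeroPart y) := by
  induction x using G.homogeneous_induction with
  | zero => simp
  | add a b ha hb => simp only [add_mul, map_add, ha, hb]
  | homogeneous m a ha =>
    induction y using G.homogeneous_induction with
    | zero => simp
    | add c d hc hd => simp only [mul_add, map_add, hc, hd]
    | homogeneous n b hb =>
      have hab := G.mul_mem ha hb
      by_cases hm : m = 0
      · subst hm
        by_cases hn : n = 0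
        · subst hn
          rw [← map_mul, G.degZeroPart_of_mem ha, G.degZeroPart_of_mem hb,
            G.degZeroPart_of_mem (by simpa using hab)]
          rfl
        · rw [G.degZeroPart_of_mem_ne hn hb, G.degZeroPart_of_mem_ne (by simpa using hn) hab]
          simp
      · rw [G.degZeroPart_of_mem_ne hm ha, map_zero, zero_mul]
        by_cases hmn : m + n = 0
        · obtain rfl : n = -m := by omega
          have hab0 : a * b ∈ G.deg 0 := by simpa using hab
          rw [G.degZeroPart_of_mem hab0]
          obtain ⟨k, hk⟩ := G.isNilpotent_mul ha hb (hnil m hm a ha)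
          rw [Ideal.Quotient.eq_zero_iff_mem]
          refine hq.mem_of_pow_mem k ?_
          have : (⟨a * b, hab0⟩ : G.degZeroSubring) ^ k = 0 := Subtype.ext (by simpa using hk)
          rw [this]
          exact q.zero_mem
        · rw [G.degZeroPart_of_mem_ne hmn hab, map_zero]

/-- The quotient of `R^0` by a prime, as a quotient of `R`: all nonzero degrees map to zero. -/
noncomputable def toQuotient (hnil : ∀ n : ℤ, n ≠ 0 → ∀ a ∈ G.deg n, IsNilpotent a)
    (q : Ideal G.degZeroSubring) (hq : q.IsPrime) :
    R →+* G.degZeroSubring ⧸ q where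
  toFun x := Ideal.Quotient.mk q (G.degZeroPart x)
  map_one' := by rw [G.degZeroPart_of_mem G.one_mem]; exact map_one _
  map_mul' := G.mk_degZeroPart_mul hnil q hq
  map_zero' := by simp
  map_add' x y := by simp

/-- The contraction of a homogeneous prime to the degree-zero subring. -/
def contract (p : SpecG G) : Spec0 G.degZeroSubring :=
  ⟨p.1.comap G.degZeroSubring.subtype, by
    have := p.2.1
    exact ⟨fun h => this.ne_top ((Ideal.eq_top_iff_one _).2
      (by simpa using (Ideal.eq_top_iff_one _).1 h)), fun {x y} h => this.mem_or_mem (by simpa using h)⟩⟩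

theorem mem_of_deg_ne_zero (hnil : ∀ n : ℤ, n ≠ 0 → ∀ a ∈ G.deg n, IsNilpotent a)
    (p : SpecG G) {n : ℤ} (hn : n ≠ 0) {a : R} (ha : a ∈ G.deg n) :
    a ∈ p.1 := by
  obtain ⟨k, hk⟩ := hnil n hn a ha
  exact p.2.1.mem_of_pow_mem k (by rw [hk]; exact p.1.zero_mem)

theorem contract_le_iff (hnil : ∀ n : ℤ, n ≠ 0 → ∀ a ∈ G.deg n, IsNilpotent a)
    (p p' : SpecG G) : G.contract p ≤ G.contract p' ↔ p ≤ p' := by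
  constructor
  · intro h
    change p.1 ≤ p'.1
    rw [show p.1 = _ from p.2.2, Ideal.span_le]
    rintro a ⟨ha, n, han⟩
    by_cases hn : n = 0
    · subst hn
      exact h (show (⟨a, han⟩ : G.degZeroSubring) ∈ (G.contract p).1 from ha)
    · exact G.mem_of_deg_ne_zero hnil p' hn han
  · intro h s hs
    exact h hs

theorem contract_surjective (hnil : ∀ n : ℤ, n ≠ 0 → ∀ a ∈ G.deg n, IsNilpotent a)
    : Function.Surjective G.contract := by
  rintro ⟨q, hq⟩
  have hker : ∀ x, x ∈ RingHom.ker (G.toQuotient hnil q hq) ↔ G.degZeroPart x ∈ q := fun x => by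
    rw [RingHom.mem_ker]
    exact Ideal.Quotient.eq_zero_iff_mem
  have hprime : (RingHom.ker (G.toQuotient hnil q hq)).IsPrime := RingHom.ker_isPrime _
  refine ⟨⟨RingHom.ker (G.toQuotient hnil q hq), hprime, ?_⟩, ?_⟩
  · refine le_antisymm (fun x hx => ?_) (Ideal.span_le.2 fun a ha => ha.1)
    have hx0 : ((G.degZeroPart x : R)) ∈ Ideal.span
        {a : R | a ∈ RingHom.ker (G.toQuotient hnil q hq) ∧ ∃ n : ℤ, a ∈ G.deg n} := by
      refine Ideal.subset_span ⟨?_, 0, (G.degZeroPart x).2⟩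
      rw [hker, G.degZeroPart_of_mem (G.degZeroPart x).2]
      exact (hker x).1 hx
    have hrest : ∀ y : R, y - G.degZeroPart y ∈ Ideal.span
        {a : R | a ∈ RingHom.ker (G.toQuotient hnil q hq) ∧ ∃ n : ℤ, a ∈ G.deg n} := by
      intro y
      induction y using G.homogeneous_induction with
      | zero => simp
      | add a b ha hb =>
        have : a + b - (G.degZeroPart (a + b) : R) =
            (a - G.degZeroPart a) + (b - G.degZeroPart b) := by
          simp only [map_add, Subring.coe_add]; abel
        rw [this]
        exact Ideal.add_mem _ ha hb
      | homogeneous n a ha =>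
        by_cases hn : n = 0
        · subst hn
          simp [G.degZeroPart_of_mem ha]
        · refine Ideal.subset_span ⟨?_, n, ?_⟩
          · rw [hker, G.degZeroPart_of_mem_ne hn ha]
            simp [G.degZeroPart_of_mem_ne hn ha]
          · simpa [G.degZeroPart_of_mem_ne hn ha] using ha
    have := Ideal.add_mem _ (hrest x) hx0
    simpa using this
  · refine Subtype.ext (Ideal.ext fun s => ?_)
    change (s : R) ∈ RingHom.ker (G.toQuotient hnil q hq) ↔ s ∈ q
    rw [hker, G.degZeroPart_of_mem s.2]

/-- If all elements of nonzero degree are nilpotent, the homogeneous spectrum of `R` is that of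
`R^0`. -/
noncomputable def contractIso (hnil : ∀ n : ℤ, n ≠ 0 → ∀ a ∈ G.deg n, IsNilpotent a)
    : SpecG G ≃o Spec0 G.degZeroSubring where
  toEquiv := Equiv.ofBijective G.contract
    ⟨fun p p' h => le_antisymm ((G.contract_le_iff hnil p p').1 h.le)
      ((G.contract_le_iff hnil p' p).1 h.ge), G.contract_surjective hnil⟩
  map_rel_iff' := G.contract_le_iff hnil _ _

theorem mem_contractIso (hnil : ∀ n : ℤ, n ≠ 0 → ∀ a ∈ G.deg n, IsNilpotent a)
    (p : SpecG G) (s : G.degZeroSubring) :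
    s ∈ (G.contractIso hnil p).1 ↔ (s : R) ∈ p.1 := Iff.rfl

end GradedCommNoethRing
end

section
variable {C : Type u} [Category.{v} C] [HasZeroObject C] [Preadditive C]
  [HasShift C ℤ] [∀ n : ℤ, (shiftFunctor C n).Additive] [Pretriangulated C]

section Reindex

variable {P Q : Type} [PartialOrder P] [PartialOrder Q]

theorem SpecializationClosed.preimage (e : P ≃o Q) {V : Set Q} (hV : SpecializationClosed V) :
    SpecializationClosed (e ⁻¹' V) :=
  fun _ _ hp hpq => hV hp (e.monotone hpq)

namespace BIKPackage

/-- Transport of a package of local (co)homology functors along an isomorphism of posets. -/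
def reindex (B : BIKPackage C P) (e : P ≃o Q) : BIKPackage C Q where
  gam _ hV := B.gam _ (hV.preimage e)
  loc _ hV := B.loc _ (hV.preimage e)
  lam _ hV := B.lam _ (hV.preimage e)
  vee _ hV := B.vee _ (hV.preimage e)
  gamToId _ hV := B.gamToId _ (hV.preimage e)
  idToLoc _ hV := B.idToLoc _ (hV.preimage e)
  conn _ hV := B.conn _ (hV.preimage e)
  triangle_dist _ hV := B.triangle_dist _ (hV.preimage e)
  gam_adj _ hV := B.gam_adj _ (hV.preimage e)
  loc_adj _ hV := B.loc_adj _ (hV.preimage e)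
  gam_acyclic _ hV := B.gam_acyclic _ (hV.preimage e)
  loc_local _ hV := B.loc_local _ (hV.preimage e)

variable (B : BIKPackage C P) (e : P ≃o Q)

theorem preimage_notDown (p : P) : e ⁻¹' {q | ¬ q ≤ e p} = {q | ¬ q ≤ p} := by
  ext; simp

theorem preimage_up (p : P) : e ⁻¹' {q | e p ≤ q} = {q | p ≤ q} := by
  ext; simp

theorem reindex_gl (p : P) : (B.reindex e).gl (e p) = B.gl p := by
  have h : ∀ (V V' W W' : Set P) (hV hV' hW hW'), V = V' → W = W' →
      B.loc V hV ⋙ B.gam W hW = B.loc V' hV' ⋙ B.gam W' hW' := by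
    rintro V _ W _ _ _ _ _ rfl rfl; rfl
  exact h _ _ _ _ _ _ _ _ (preimage_notDown e p) (preimage_up e p)

theorem reindex_lv (p : P) : (B.reindex e).lv (e p) = B.lv p := by
  have h : ∀ (V V' W W' : Set P) (hV hV' hW hW'), V = V' → W = W' →
      B.vee V hV ⋙ B.lam W hW = B.vee V' hV' ⋙ B.lam W' hW' := by
    rintro V _ W _ _ _ _ _ rfl rfl; rfl
  exact h _ _ _ _ _ _ _ _ (preimage_notDown e p) (preimage_up e p)

theorem reindex_stratified : (B.reindex e).Stratified ↔ B.Stratified := by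
  have hr : ∀ X : C, (Set.range fun q => ((B.reindex e).gl q).obj X) =
      Set.range fun p => (B.gl p).obj X := fun X => by
    rw [← e.surjective.range_comp]
    simp only [Function.comp_def, reindex_gl]
  simp only [Stratified, hr, e.surjective.forall, reindex_gl]

theorem reindex_costratified : (B.reindex e).Costratified ↔ B.Costratified := by
  have hr : ∀ X : C, (Set.range fun q => ((B.reindex e).lv q).obj X) =
      Set.range fun p => (B.lv p).obj X := fun X => by
    rw [← e.surjective.range_comp]
    simp only [Function.comp_def, reindex_lv]
  simp only [Costratified, hr, e.surjective.forall, reindex_lv]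

end BIKPackage

end Reindex

section Action

variable {R : Type} [Ring R] {G : GradedCommNoethRing R} (A : RAction C G)

namespace RAction

theorem restrictDegZero_mul (X : C) (r s : G.degZeroSubring) :
    A.restrictDegZero C X (r * s) = A.restrictDegZero C X r ≫ A.restrictDegZero C X s := by
  have cast : ∀ (n : ℤ) (hn : 0 + 0 = n) (hx : (r * s : R) ∈ G.deg n),
      A.act X n ⟨r * s, hx⟩ = A.act X 0 ⟨r, r.2⟩ ≫ (A.act X 0 ⟨s, s.2⟩)⟦(0 : ℤ)⟧' ≫
        (shiftFunctorAdd' C 0 0 n hn).inv.app X := by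
    rintro _ rfl hx
    exact A.act_mul X ⟨r, r.2⟩ ⟨s, s.2⟩
  have hmem : (r * s : R) ∈ G.deg 0 := (r * s).2
  change A.act X 0 ⟨r * s, hmem⟩ ≫ (shiftFunctorZero C ℤ).hom.app X =
    (A.act X 0 ⟨r, r.2⟩ ≫ (shiftFunctorZero C ℤ).hom.app X) ≫
      A.act X 0 ⟨s, s.2⟩ ≫ (shiftFunctorZero C ℤ).hom.app X
  have hnat := (shiftFunctorZero C ℤ).hom.naturality (A.act X 0 ⟨s, s.2⟩)
  dsimp at hnat
  rw [cast 0 (zero_add 0), shiftFunctorAdd'_add_zero_inv_app]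
  simp only [Category.assoc]
  rw [reassoc_of% hnat]

theorem restrictDegZero_naturality {X Y : C} (f : X ⟶ Y) (s : G.degZeroSubring) :
    f ≫ A.restrictDegZero C Y s = A.restrictDegZero C X s ≫ f := by
  unfold restrictDegZero
  rw [← Category.assoc, A.act_central, Category.assoc, Category.assoc]
  congr 1
  exact (shiftFunctorZero C ℤ).hom.naturality f

/-- The restricted action as a homomorphism from `R^0` to the centre. -/
def degZeroCenter : G.degZeroSubring →+* End (𝟭 C) where
  toFun s :=
    { app := fun X => A.restrictDegZero C X s
      naturality := fun _ _ f => A.restrictDegZero_naturality f s }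
  map_one' := by
    ext X
    change A.act X 0 ⟨1, G.one_mem⟩ ≫ _ = 𝟙 X
    rw [A.act_one]
    simp
  map_mul' r s := by
    ext X
    change A.restrictDegZero C X (r * s) = A.restrictDegZero C X s ≫ A.restrictDegZero C X r
    rw [mul_comm, restrictDegZero_mul]
  map_zero' := by
    ext X
    change A.act X 0 0 ≫ _ = 0
    have : A.act X 0 0 = 0 := by simpa using A.act_add X 0 0 0
    rw [this, zero_comp]
  map_add' r s := by
    ext X
    change A.act X 0 (⟨r.1, r.2⟩ + ⟨s.1, s.2⟩) ≫ _ = A.act X 0 ⟨r.1, r.2⟩ ≫ _ + A.act X 0 ⟨s.1, s.2⟩ ≫ _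
    rw [A.act_add, Preadditive.add_comp]

end RAction
end Action

section Compact

open scoped Classical in
theorem coproductComparison_of {ι : Type v} (X : C) (f : ι → C) [HasCoproduct f] (i : ι)
    (g : X ⟶ f i) :
    coproductComparison C X f (DirectSum.of (fun i => (X ⟶ f i)) i g) = g ≫ Sigma.ι f i :=
  DirectSum.toAddMonoid_of _ _ _

/-- Compactness, expressed by finite sums of maps into the summands of a coproduct. -/
theorem isCompactObj_iff (X : C) :
    IsCompactObj C X ↔ ∀ {ι : Type v} (f : ι → C) [HasCoproduct f] (g : X ⟶ ∐ f),
      ∃ (s : Finset ι) (h : ∀ i, X ⟶ f i), g = ∑ i ∈ s, h i ≫ Sigma.ι f i := by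
  classical
  constructor
  · intro hX ι f _ g
    obtain ⟨x, rfl⟩ := (hX f).2 g
    refine ⟨DFinsupp.support x, fun i => x i, ?_⟩
    conv_lhs => rw [← DirectSum.sum_support_of x]
    rw [map_sum]
    exact Finset.sum_congr rfl fun i _ => coproductComparison_of X f i _
  · intro h ι f _
    constructor
    · have hπ : ∀ (x : DirectSum ι fun i => (X ⟶ f i)) (j : ι),
          coproductComparison C X f x ≫ Sigma.π f j = x j := by
        intro x j
        induction x using DirectSum.induction_on with
        | zero => simp
        | of i g =>
          rw [coproductComparison_of, Category.assoc]
          obtain rfl | hij := eq_or_ne i j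
          · rw [Sigma.ι_π_eq_id, DirectSum.of_eq_same, Category.comp_id]
          · rw [Sigma.ι_π_of_ne f hij, DirectSum.of_eq_of_ne _ _ _ hij.symm, comp_zero]
        | add x y hx hy => rw [map_add, Preadditive.add_comp, hx, hy, DirectSum.add_apply]
      intro x y hxy
      refine DFinsupp.ext fun j => ?_
      rw [← hπ x j, ← hπ y j, hxy]
    · intro g
      obtain ⟨s, h, rfl⟩ := h f g
      refine ⟨∑ i ∈ s, DirectSum.of _ i (h i), ?_⟩
      rw [map_sum]
      exact Finset.sum_congr rfl fun i _ => coproductComparison_of X f i _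

variable [HasCoproducts.{v} C]

/-- Shifting a compact object gives a compact object. -/
theorem IsCompactObj.shift {W : C} (hW : IsCompactObj C W) (n : ℤ) : IsCompactObj C (W⟦n⟧) := by
  rw [isCompactObj_iff] at hW ⊢
  intro ι f _ g
  obtain ⟨s, h, hs⟩ := hW (fun i => (f i)⟦-n⟧)
    ((shiftFunctorCompIsoId C n (-n) (by omega)).inv.app W ≫ g⟦-n⟧' ≫
      (PreservesCoproduct.iso (shiftFunctor C (-n)) f).hom)
  choose k hk using fun i => (shiftFunctor C (-n)).map_surjective
    ((shiftFunctorCompIsoId C n (-n) (by omega)).hom.app W ≫ h i)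
  refine ⟨s, k, (shiftFunctor C (-n)).map_injective ?_⟩
  rw [Functor.map_sum]
  have hι : ∀ i, Sigma.ι (fun i => (f i)⟦-n⟧) i ≫
      (PreservesCoproduct.iso (shiftFunctor C (-n)) f).inv = (Sigma.ι f i)⟦-n⟧' := fun i => by
    rw [PreservesCoproduct.inv_hom, ι_comp_sigmaComparison]
  have hg : g⟦-n⟧' = (shiftFunctorCompIsoId C n (-n) (by omega)).hom.app W ≫
      (∑ i ∈ s, h i ≫ Sigma.ι (fun i => (f i)⟦-n⟧) i) ≫
        (PreservesCoproduct.iso (shiftFunctor C (-n)) f).inv := by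
    simp [← hs, -PreservesCoproduct.inv_hom]
  simp only [hg, Preadditive.sum_comp, Preadditive.comp_sum, Functor.map_comp, hk, Category.assoc,
    hι]

end Compact

section KerChar

variable [HasCoproducts.{v} C] {S : Type} [CommRing S] (φ : S →+* End (𝟭 C))

/-- The kernels of the localization functors of `B` are those determined by the action `φ`. -/
def BIKPackage.KerChar (B : BIKPackage C (Spec0 S)) : Prop :=
  ∀ V hV (X : C), IsZero ((B.loc V hV).obj X) ↔
    ∀ q : Spec0 S, q ∉ V → ∀ W : C, IsCompactObj C W → ∀ w : W ⟶ X,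
      ∃ s : S, s ∉ q.1 ∧ w ≫ (φ s).app X = 0

theorem forall_shift_iff {X : C} (q : Spec0 S) :
    (∀ W : C, IsCompactObj C W → ∀ (n : ℤ) (g : W ⟶ X⟦n⟧),
      ∃ s : S, s ∉ q.1 ∧ g ≫ ((φ s).app X)⟦(n : ℤ)⟧' = 0) ↔
    ∀ W : C, IsCompactObj C W → ∀ w : W ⟶ X, ∃ s : S, s ∉ q.1 ∧ w ≫ (φ s).app X = 0 := by
  constructor
  · intro h W hW w
    obtain ⟨s, hs, hs'⟩ := h W hW 0 (w ≫ (shiftFunctorZero C ℤ).inv.app X)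
    refine ⟨s, hs, ?_⟩
    have hnat := (shiftFunctorZero C ℤ).inv.naturality ((φ s).app X)
    dsimp at hnat
    rw [Category.assoc, ← hnat, ← Category.assoc] at hs'
    exact (cancel_mono _).1 (hs'.trans zero_comp.symm)
  · intro h W hW n g
    obtain ⟨s, hs, hs'⟩ := h _ (hW.shift (-n))
      (g⟦-n⟧' ≫ (shiftFunctorCompIsoId C n (-n) (by omega)).hom.app X)
    refine ⟨s, hs, ?_⟩
    have hnat := (shiftFunctorCompIsoId C n (-n) (by omega)).hom.naturality ((φ s).app X)
    dsimp at hnat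
    apply (shiftFunctor C (-n)).map_injective
    rw [Category.assoc] at hs'
    erw [← hnat] at hs'
    rw [← Category.assoc] at hs'
    rw [Functor.map_comp, Functor.map_zero]
    exact (cancel_mono _).1 (hs'.trans zero_comp.symm)

end KerChar

end

section
variable {C : Type u} [Category.{v} C] [HasZeroObject C] [Preadditive C]
  [HasShift C ℤ] [∀ n : ℤ, (shiftFunctor C n).Additive] [Pretriangulated C]

section Exactness

variable {X Y Z : C} {f : X ⟶ Y} {g : Y ⟶ Z} {h : Z ⟶ X⟦(1 : ℤ)⟧}

theorem exists_lift_mor₁ (hD : Triangle.mk f g h ∈ distTriang C) {W : C} (k : W ⟶ Y)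
    (hk : k ≫ g = 0) : ∃ l : W ⟶ X, l ≫ f = k :=
  let ⟨l, hl⟩ := Triangle.coyoneda_exact₂ _ hD k hk
  ⟨l, hl.symm⟩

theorem exists_lift_mor₂ (hD : Triangle.mk f g h ∈ distTriang C) {W : C} (k : W ⟶ Z)
    (hk : k ≫ h = 0) : ∃ l : W ⟶ Y, l ≫ g = k :=
  let ⟨l, hl⟩ := Triangle.coyoneda_exact₃ _ hD k hk
  ⟨l, hl.symm⟩

theorem exists_lift_mor₃ (hD : Triangle.mk f g h ∈ distTriang C) {W : C} (k : W ⟶ X⟦(1 : ℤ)⟧)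
    (hk : k ≫ f⟦(1 : ℤ)⟧' = 0) : ∃ l : W ⟶ Z, l ≫ h = k :=
  let ⟨l, hl⟩ := Triangle.coyoneda_exact₁ _ hD k hk
  ⟨l, hl.symm⟩

theorem exists_desc_mor₂ (hD : Triangle.mk f g h ∈ distTriang C) {W : C} (k : Y ⟶ W)
    (hk : f ≫ k = 0) : ∃ l : Z ⟶ W, g ≫ l = k :=
  let ⟨l, hl⟩ := Triangle.yoneda_exact₂ _ hD k hk
  ⟨l, hl.symm⟩

theorem exists_desc_mor₃ (hD : Triangle.mk f g h ∈ distTriang C) {W : C} (k : Z ⟶ W)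
    (hk : g ≫ k = 0) : ∃ l : X⟦(1 : ℤ)⟧ ⟶ W, h ≫ l = k :=
  let ⟨l, hl⟩ := Triangle.yoneda_exact₃ _ hD k hk
  ⟨l, hl.symm⟩

end Exactness

namespace BIKPackage

variable {P : Type} [PartialOrder P] (B B' : BIKPackage C P)
  {V : Set P} (hV : SpecializationClosed V)

/-- The counit `Γ_V X ⟶ X`. -/
def γ (X : C) : (B.gam V hV).obj X ⟶ X := (B.gamToId V hV).app X

/-- The unit `X ⟶ L_V X`. -/
def η (X : C) : X ⟶ (B.loc V hV).obj X := (B.idToLoc V hV).app X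

theorem γ_naturality {X Y : C} (f : X ⟶ Y) : (B.gam V hV).map f ≫ B.γ hV Y = B.γ hV X ≫ f :=
  (B.gamToId V hV).naturality f

theorem η_naturality {X Y : C} (f : X ⟶ Y) : f ≫ B.η hV Y = B.η hV X ≫ (B.loc V hV).map f :=
  (B.idToLoc V hV).naturality f

theorem triangle_mem (X : C) : Triangle.mk (B.γ hV X) (B.η hV X) (B.conn V hV X) ∈ distTriang C :=
  B.triangle_dist V hV X

theorem isZero_loc_of_η_eq_zero {X : C} (h : B.η hV X = 0) :
    IsZero ((B.loc V hV).obj X) := by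
  obtain ⟨s, hs⟩ := exists_lift_mor₁ (B.triangle_mem hV X) (𝟙 X) (by rw [h, comp_zero])
  rw [IsZero.iff_id_eq_zero, ← (B.loc V hV).map_id]
  rw [← hs, Functor.map_comp, (B.gam_acyclic V hV X).eq_of_tgt ((B.loc V hV).map s) 0, zero_comp]

theorem isZero_loc_iff {X : C} :
    IsZero ((B.loc V hV).obj X) ↔ ∀ (Y : C) (g : X ⟶ (B.loc V hV).obj Y), g = 0 :=
  ⟨fun h Y g => B.loc_local V hV X Y h g, fun h => B.isZero_loc_of_η_eq_zero hV (h X _)⟩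

theorem isZero_loc_of_iso {X Y : C} (e : X ≅ Y) (h : IsZero ((B.loc V hV).obj X)) :
    IsZero ((B.loc V hV).obj Y) :=
  h.of_iso ((B.loc V hV).mapIso e.symm)

theorem isZero_loc_of_retract {X Y : C} (i : X ⟶ Y) (r : Y ⟶ X) (hir : i ≫ r = 𝟙 X)
    (h : IsZero ((B.loc V hV).obj Y)) : IsZero ((B.loc V hV).obj X) := by
  rw [isZero_loc_iff] at h ⊢
  intro Z g
  rw [← Category.id_comp g, ← hir, Category.assoc, h Z (r ≫ g), comp_zero]

theorem isZero_loc_of_triangle (D : Triangle C) (hD : D ∈ distTriang C)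
    (h₁ : IsZero ((B.loc V hV).obj D.obj₁)) (h₃ : IsZero ((B.loc V hV).obj D.obj₃)) :
    IsZero ((B.loc V hV).obj D.obj₂) := by
  rw [isZero_loc_iff] at h₁ h₃ ⊢
  intro Z g
  obtain ⟨k, rfl⟩ := Triangle.yoneda_exact₂ D hD g (h₁ Z _)
  rw [h₃ Z k, comp_zero]

theorem isZero_loc_coprod {ι : Type v} (f : ι → C) [HasCoproduct f]
    (h : ∀ i, IsZero ((B.loc V hV).obj (f i))) : IsZero ((B.loc V hV).obj (∐ f)) := by
  rw [isZero_loc_iff]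
  intro Z g
  refine Sigma.hom_ext _ _ fun i => ?_
  rw [comp_zero]
  exact (B.isZero_loc_iff hV).1 (h i) Z _

theorem isIso_γ_iff {X : C} : IsIso (B.γ hV X) ↔ IsZero ((B.loc V hV).obj X) :=
  (Triangle.isZero₃_iff_isIso₁ _ (B.triangle_mem hV X)).symm

theorem isZero_loc_of_isZero {X : C} (h : IsZero X) : IsZero ((B.loc V hV).obj X) := by
  rw [isZero_loc_iff]
  exact fun Z g => h.eq_of_src g 0

theorem exists_lift_gam {K : C} (hK : IsZero ((B.loc V hV).obj K)) {X : C} (f : K ⟶ X) :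
    ∃ s : K ⟶ (B.gam V hV).obj X, s ≫ B.γ hV X = f :=
  exists_lift_mor₁ (B.triangle_mem hV X) f (B.loc_local V hV _ _ hK _)

theorem gam_hom_ext {K X : C} (hK : IsZero ((B.loc V hV).obj (K⟦(1 : ℤ)⟧)))
    {s t : K ⟶ (B.gam V hV).obj X} (h : s ≫ B.γ hV X = t ≫ B.γ hV X) : s = t := by
  rw [← sub_eq_zero] at h ⊢
  rw [← Preadditive.sub_comp] at h
  apply (shiftFunctor C (1 : ℤ)).map_injective
  obtain ⟨k, hk⟩ := exists_lift_mor₃ (B.triangle_mem hV X) ((s - t)⟦(1 : ℤ)⟧') (by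
    rw [← Functor.map_comp, h, Functor.map_zero])
  rw [← hk, B.loc_local V hV _ _ hK k, zero_comp, Functor.map_zero]

theorem exists_desc_loc {X Y : C}
    (hY : ∀ K : C, IsZero ((B.loc V hV).obj K) → ∀ g : K ⟶ Y, g = 0) (f : X ⟶ Y) :
    ∃ s : (B.loc V hV).obj X ⟶ Y, B.η hV X ≫ s = f :=
  exists_desc_mor₂ (B.triangle_mem hV X) f (hY _ (B.gam_acyclic V hV X) _)

/-- The kernels of the localization functors are closed under all shifts. -/
def ShiftStable : Prop :=
  ∀ V hV (X : C), IsZero ((B.loc V hV).obj X) → ∀ n : ℤ, IsZero ((B.loc V hV).obj (X⟦n⟧))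

variable {B B'}

theorem loc_hom_ext (hB : B.ShiftStable) {X Y : C}
    (hY : ∀ K : C, IsZero ((B.loc V hV).obj K) → ∀ g : K ⟶ Y, g = 0)
    {s t : (B.loc V hV).obj X ⟶ Y} (h : B.η hV X ≫ s = B.η hV X ≫ t) : s = t := by
  rw [← sub_eq_zero] at h ⊢
  rw [← Preadditive.comp_sub] at h
  obtain ⟨k, hk⟩ := exists_desc_mor₃ (B.triangle_mem hV X) (s - t) h
  rw [← hk, hY _ (hB V hV _ (B.gam_acyclic V hV X) 1) k, comp_zero]

/-- The torsion functor is determined by the kernel of the localization functor. -/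
theorem nonempty_gam_iso (hB : B.ShiftStable) (hB' : B'.ShiftStable)
    (h : ∀ V hV (X : C), IsZero ((B.loc V hV).obj X) ↔ IsZero ((B'.loc V hV).obj X)) :
    Nonempty (B.gam V hV ≅ B'.gam V hV) := by
  choose f hf using fun X => B'.exists_lift_gam hV
    ((h V hV _).1 (B.gam_acyclic V hV X)) (B.γ hV X)
  choose g hg using fun X => B.exists_lift_gam hV
    ((h V hV _).2 (B'.gam_acyclic V hV X)) (B'.γ hV X)
  have hz : ∀ X, IsZero ((B.loc V hV).obj (((B.gam V hV).obj X)⟦(1 : ℤ)⟧)) :=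
    fun X => hB V hV _ (B.gam_acyclic V hV X) 1
  have hz' : ∀ X, IsZero ((B'.loc V hV).obj (((B'.gam V hV).obj X)⟦(1 : ℤ)⟧)) :=
    fun X => hB' V hV _ (B'.gam_acyclic V hV X) 1
  refine ⟨NatIso.ofComponents (fun X => ⟨f X, g X,
    B.gam_hom_ext hV (hz X) (by rw [Category.assoc, hg, hf, Category.id_comp]),
    B'.gam_hom_ext hV (hz' X) (by rw [Category.assoc, hf, hg, Category.id_comp])⟩) fun {X Y} k => ?_⟩
  refine B'.gam_hom_ext hV ((h V hV _).1 (hz X)) ?_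
  dsimp
  rw [Category.assoc, Category.assoc, hf, γ_naturality, γ_naturality, reassoc_of% hf X]

/-- The localization functor is determined by its kernel. -/
theorem nonempty_loc_iso (hB : B.ShiftStable) (hB' : B'.ShiftStable)
    (h : ∀ V hV (X : C), IsZero ((B.loc V hV).obj X) ↔ IsZero ((B'.loc V hV).obj X)) :
    Nonempty (B.loc V hV ≅ B'.loc V hV) := by
  have hl : ∀ X K : C, IsZero ((B.loc V hV).obj K) → ∀ g : K ⟶ (B'.loc V hV).obj X, g = 0 :=
    fun X K hK g => B'.loc_local V hV K X ((h V hV K).1 hK) g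
  have hl' : ∀ X K : C, IsZero ((B'.loc V hV).obj K) → ∀ g : K ⟶ (B.loc V hV).obj X, g = 0 :=
    fun X K hK g => B.loc_local V hV K X ((h V hV K).2 hK) g
  choose f hf using fun X => B.exists_desc_loc hV (hl X) (B'.η hV X)
  choose g hg using fun X => B'.exists_desc_loc hV (hl' X) (B.η hV X)
  refine ⟨NatIso.ofComponents (fun X => ⟨f X, g X,
    loc_hom_ext hV hB (fun K hK => B.loc_local V hV K X hK)
      (by rw [reassoc_of% hf X, hg, Category.comp_id]),
    loc_hom_ext hV hB' (fun K hK => B'.loc_local V hV K X hK)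
      (by rw [reassoc_of% hg X, hf, Category.comp_id])⟩) fun {X Y} k => ?_⟩
  refine loc_hom_ext hV hB (hl Y) ?_
  dsimp
  rw [← Category.assoc, ← η_naturality, Category.assoc, hf, η_naturality, reassoc_of% hf X]

theorem nonempty_gl_iso (hB : B.ShiftStable) (hB' : B'.ShiftStable)
    (h : ∀ V hV (X : C), IsZero ((B.loc V hV).obj X) ↔ IsZero ((B'.loc V hV).obj X)) (p : P) :
    Nonempty (B.gl p ≅ B'.gl p) := by
  obtain ⟨e⟩ := nonempty_loc_iso (specializationClosed_notDown p) hB hB' h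
  obtain ⟨e'⟩ := nonempty_gam_iso (specializationClosed_up p) hB hB' h
  exact ⟨NatIso.hcomp e e'⟩

theorem nonempty_lv_iso (hB : B.ShiftStable) (hB' : B'.ShiftStable)
    (h : ∀ V hV (X : C), IsZero ((B.loc V hV).obj X) ↔ IsZero ((B'.loc V hV).obj X)) (p : P) :
    Nonempty (B.lv p ≅ B'.lv p) := by
  obtain ⟨e⟩ := nonempty_loc_iso (specializationClosed_notDown p) hB hB' h
  obtain ⟨e'⟩ := nonempty_gam_iso (specializationClosed_up p) hB hB' h
  exact ⟨NatIso.hcomp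
    ((B.loc_adj _ _).rightAdjointUniq ((B'.loc_adj _ _).ofNatIsoLeft e.symm))
    ((B.gam_adj _ _).rightAdjointUniq ((B'.gam_adj _ _).ofNatIsoLeft e'.symm))⟩

end BIKPackage

theorem Loc_range_congr {ι : Type} {f g : ι → C} (h : ∀ i, Nonempty (f i ≅ g i)) :
    Loc C (Set.range f) = Loc C (Set.range g) := by
  have key : ∀ {f g : ι → C}, (∀ i, Nonempty (f i ≅ g i)) →
      Loc C (Set.range f) ⊆ Loc C (Set.range g) := by
    rintro f g h X hX S ⟨hS, hgS⟩
    refine hX S ⟨hS, ?_⟩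
    rintro _ ⟨i, rfl⟩
    exact hS.iso_mem (h i).some.symm (hgS ⟨i, rfl⟩)
  exact (key h).antisymm (key fun i => ⟨(h i).some.symm⟩)

theorem Coloc_range_congr {ι : Type} {f g : ι → C} (h : ∀ i, Nonempty (f i ≅ g i)) :
    Coloc C (Set.range f) = Coloc C (Set.range g) := by
  have key : ∀ {f g : ι → C}, (∀ i, Nonempty (f i ≅ g i)) →
      Coloc C (Set.range f) ⊆ Coloc C (Set.range g) := by
    rintro f g h X hX S ⟨hS, hgS⟩
    refine hX S ⟨hS, ?_⟩
    rintro _ ⟨i, rfl⟩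
    exact hS.iso_mem (h i).some.symm (hgS ⟨i, rfl⟩)
  exact (key h).antisymm (key fun i => ⟨(h i).some.symm⟩)

theorem essImageSet_congr {F F' : C ⥤ C} (e : F ≅ F') : essImageSet C F = essImageSet C F' := by
  ext Y
  exact ⟨fun ⟨X, ⟨k⟩⟩ => ⟨X, ⟨e.symm.app X ≪≫ k⟩⟩, fun ⟨X, ⟨k⟩⟩ => ⟨X, ⟨e.app X ≪≫ k⟩⟩⟩

namespace BIKPackage

variable {P : Type} [PartialOrder P] {B B' : BIKPackage C P}

theorem Stratified.of_iso (h : ∀ p, Nonempty (B.gl p ≅ B'.gl p)) (hB : B.Stratified) :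
    B'.Stratified := by
  refine ⟨fun X => ?_, fun p => ?_⟩
  · rw [hB.1 X]
    exact Loc_range_congr fun p => ⟨(h p).some.app X⟩
  · rw [← essImageSet_congr (h p).some]
    exact hB.2 p

theorem Costratified.of_iso (h : ∀ p, Nonempty (B.lv p ≅ B'.lv p)) (hB : B.Costratified) :
    B'.Costratified := by
  refine ⟨fun X => ?_, fun p => ?_⟩
  · rw [hB.1 X]
    exact Coloc_range_congr fun p => ⟨(h p).some.app X⟩
  · rw [← essImageSet_congr (h p).some]
    exact hB.2 p

end BIKPackage

end

section
variable {C : Type u} [Category.{v} C] [HasZeroObject C] [Preadditive C]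
  [HasShift C ℤ] [∀ n : ℤ, (shiftFunctor C n).Additive] [Pretriangulated C]
  [HasCoproducts.{v} C]

namespace BIKPackage

variable {P : Type} [PartialOrder P] (B : BIKPackage C P)

theorem isLocalizing_shift_ker {V : Set P} (hV : SpecializationClosed V) :
    IsLocalizing C {Y : C | ∀ m : ℤ, IsZero ((B.loc V hV).obj (Y⟦m⟧))} where
  iso_mem e h m := B.isZero_loc_of_iso hV ((shiftFunctor C m).mapIso e) (h m)
  zero_mem h m := B.isZero_loc_of_isZero hV ((shiftFunctor C m).map_isZero h)
  shift_mem X n h m := B.isZero_loc_of_iso hV ((shiftFunctorAdd C n m).app X) (h (n + m))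
  ext_mem D hD h₁ h₃ m :=
    B.isZero_loc_of_triangle hV _ (Triangle.shift_distinguished D hD m) (h₁ m) (h₃ m)
  retract_mem X Y i r hir h m := B.isZero_loc_of_retract hV (i⟦m⟧') (r⟦m⟧')
    (by rw [← Functor.map_comp, hir, CategoryTheory.Functor.map_id]) (h m)
  coprod_mem f _ h m := B.isZero_loc_of_iso hV (PreservesCoproduct.iso (shiftFunctor C m) f).symm
    (B.isZero_loc_coprod hV _ fun i => h i m)

theorem isZero_gam_of_isZero {V : Set P} (hV : SpecializationClosed V) {X : C} (h : IsZero X) :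
    IsZero ((B.gam V hV).obj X) :=
  have := (B.isIso_γ_iff hV).2 (B.isZero_loc_of_isZero hV h)
  h.of_iso (asIso (B.γ hV X))

variable {B}

theorem Stratified.shiftStable (hB : B.Stratified)
    (hmono : ∀ (V W : Set P) (hV : SpecializationClosed V) (hW : SpecializationClosed W), V ⊆ W →
      ∀ X, IsZero ((B.loc V hV).obj X) → IsZero ((B.loc W hW).obj X)) : B.ShiftStable := by
  intro V hV X hX
  have hX' : X ∈ Loc C (Set.range fun p : P => (B.gl p).obj X) := by
    rw [← hB.1 X]
    exact fun S hS => hS.2 rfl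
  refine hX' _ ⟨B.isLocalizing_shift_ker hV, ?_⟩
  rintro _ ⟨p, rfl⟩
  by_cases hp : p ∈ V
  · have hsub : ∀ Y ∈ essImageSet C (B.gl p), IsZero ((B.loc V hV).obj Y) := by
      rintro Y ⟨Z, ⟨e⟩⟩
      exact B.isZero_loc_of_iso hV e
        (hmono _ V _ hV (fun q hq => hV hp hq) _ (B.gam_acyclic _ _ _))
    have hmem : (B.gl p).obj X ∈ essImageSet C (B.gl p) := ⟨X, ⟨Iso.refl _⟩⟩
    rcases hB.2 p with h | h
    · exact (B.isLocalizing_shift_ker hV).zero_mem (h _ hmem)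
    · exact fun m => hsub _ (h.1.shift_mem _ m hmem)
  · have : IsZero ((B.loc _ (specializationClosed_notDown p)).obj X) :=
      hmono V _ hV _ (fun q hq hqp => hp (hV hq hqp)) _ hX
    refine (B.isLocalizing_shift_ker hV).zero_mem ?_
    exact B.isZero_gam_of_isZero _ this

theorem KerChar.mono {S : Type} [CommRing S] {φ : S →+* End (𝟭 C)} {B : BIKPackage C (Spec0 S)}
    (h : B.KerChar φ) (V W : Set (Spec0 S)) (hV : SpecializationClosed V)
    (hW : SpecializationClosed W) (hVW : V ⊆ W) (X : C) (hX : IsZero ((B.loc V hV).obj X)) :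
    IsZero ((B.loc W hW).obj X) := by
  rw [h] at hX ⊢
  exact fun q hq => hX q fun hqV => hq (hVW hqV)

end BIKPackage
end

section
variable {C : Type u} [Category.{v} C] [HasZeroObject C] [Preadditive C]
  [HasShift C ℤ] [∀ n : ℤ, (shiftFunctor C n).Additive] [Pretriangulated C]

/-- The component at `X` of an element of the centre. -/
def cen (a : End (𝟭 C)) (X : C) : X ⟶ X := a.app X

theorem comp_cen (a : End (𝟭 C)) {X Y : C} (f : X ⟶ Y) : f ≫ cen a Y = cen a X ≫ f :=
  a.naturality f

theorem cen_sub (a b : End (𝟭 C)) (X : C) : cen (a - b) X = cen a X - cen b X := rfl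

theorem cen_zero (X : C) : cen (0 : End (𝟭 C)) X = 0 := rfl

theorem cen_one (X : C) : cen (1 : End (𝟭 C)) X = 𝟙 X := rfl

theorem cen_mul (a b : End (𝟭 C)) (X : C) : cen (a * b) X = cen a X ≫ cen b X :=
  (comp_cen a (cen b X)).trans rfl

/-- The endomorphism of the identity functor whose shift is `a`, evaluated at shifted objects. -/
noncomputable def shiftEnd (a : End (𝟭 C)) : End (𝟭 C) where
  app X := (shiftFunctor C (1 : ℤ)).preimage (cen a (X⟦(1 : ℤ)⟧))
  naturality X Y f := by
    apply (shiftFunctor C (1 : ℤ)).map_injective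
    simp [comp_cen]

theorem map_cen_shiftEnd (a : End (𝟭 C)) (X : C) :
    (cen (shiftEnd a) X)⟦(1 : ℤ)⟧' = cen a (X⟦(1 : ℤ)⟧) :=
  (shiftFunctor C (1 : ℤ)).map_preimage _

/-- An element of the centre factoring every morphism as `f ≫ d = f ≫ h ≫ f`. -/
def IsRegularElement (d : End (𝟭 C)) : Prop :=
  ∀ ⦃X Y : C⦄ (f : X ⟶ Y), ∃ h : Y ⟶ X, f ≫ cen d Y = f ≫ h ≫ f

/-- The failure of an element of the centre to commute with the shift is regular. -/
theorem isRegularElement_shiftEnd_sub (a : End (𝟭 C)) : IsRegularElement (shiftEnd a - a) := by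
  intro X Y f
  obtain ⟨E, i, p, hD⟩ := distinguished_cocone_triangle₂ (f⟦(1 : ℤ)⟧')
  obtain ⟨t, ht₁, ht₂⟩ : ∃ t : X⟦(1 : ℤ)⟧ ⟶ X⟦(1 : ℤ)⟧, _ ∧ _ := complete_distinguished_triangle_morphism _ _ hD hD (cen a Y) (cen a E)
    (comp_cen a i)
  replace ht₁ : p ≫ t = cen a E ≫ p := ht₁
  replace ht₂ : f⟦(1 : ℤ)⟧' ≫ (cen a Y)⟦(1 : ℤ)⟧' = t ≫ f⟦(1 : ℤ)⟧' := ht₂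
  obtain ⟨k, hk⟩ := exists_desc_mor₃ hD (cen a (X⟦(1 : ℤ)⟧) - t)
    (by rw [Preadditive.comp_sub, comp_cen, ht₁, sub_self])
  obtain ⟨h, rfl⟩ := (shiftFunctor C (1 : ℤ)).map_surjective k
  refine ⟨h, (shiftFunctor C (1 : ℤ)).map_injective ?_⟩
  simp only [Functor.map_comp, cen_sub, Functor.map_sub, map_cen_shiftEnd, Preadditive.comp_sub]
  rw [← Category.assoc, hk, Preadditive.sub_comp, comp_cen, ht₂]

theorem IsRegularElement.neg {d : End (𝟭 C)} (hd : IsRegularElement d) : IsRegularElement (-d) := by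
  intro X Y f
  obtain ⟨h, hh⟩ := hd f
  refine ⟨-h, ?_⟩
  change f ≫ (-cen d Y) = _
  simp [hh]

/-- An object all of whose incoming morphisms are von Neumann regular. -/
def IsRegularObj (D : C) : Prop :=
  ∀ ⦃X : C⦄ (f : X ⟶ D), ∃ h : D ⟶ X, f ≫ h ≫ f = f

theorem IsRegularElement.isRegularObj {d : End (𝟭 C)} (hd : IsRegularElement d) {D : C}
    (h : IsIso (cen d D)) : IsRegularObj D := by
  intro X f
  obtain ⟨k, hk⟩ := hd f
  refine ⟨inv (cen d D) ≫ k, ?_⟩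
  have : inv (cen d D) ≫ k ≫ f = (k ≫ f) ≫ inv (cen d D) := by
    rw [IsIso.inv_comp_eq, ← Category.assoc, ← comp_cen]
    simp
  rw [Category.assoc, this, Category.assoc, ← reassoc_of% hk]
  simp

theorem IsRegularObj.of_retract {Z D : C} (hD : IsRegularObj D) (i : Z ⟶ D) (r : D ⟶ Z)
    (hir : i ≫ r = 𝟙 Z) : IsRegularObj Z := by
  intro X f
  obtain ⟨h, hh⟩ := hD (f ≫ i)
  refine ⟨i ≫ h, ?_⟩
  have := hh =≫ r
  simpa [hir] using this

theorem IsRegularObj.shift {D : C} (hD : IsRegularObj D) (n : ℤ) : IsRegularObj (D⟦n⟧) := by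
  intro X f
  obtain ⟨h, hh⟩ := hD (f⟦-n⟧' ≫ (shiftFunctorCompIsoId C n (-n) (by omega)).hom.app D)
  obtain ⟨k, hk⟩ := (shiftFunctor C (-n)).map_surjective
    ((shiftFunctorCompIsoId C n (-n) (by omega)).hom.app D ≫ h)
  refine ⟨k, (shiftFunctor C (-n)).map_injective ?_⟩
  rw [← cancel_mono ((shiftFunctorCompIsoId C n (-n) (by omega)).hom.app D)]
  simpa [hk] using hh

end

section
variable {C : Type u} [Category.{v} C] [HasZeroObject C] [Preadditive C]
  [HasShift C ℤ] [∀ n : ℤ, (shiftFunctor C n).Additive] [Pretriangulated C]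

variable [HasCoproducts.{v} C]

theorem isLocalizing_forall_shift_hom_eq_zero (X : C) :
    IsLocalizing C {Y : C | ∀ (m : ℤ) (g : Y⟦m⟧ ⟶ X), g = 0} where
  iso_mem e h m g := by
    rw [← cancel_epi ((shiftFunctor C m).map e.hom), comp_zero]
    exact h m _
  zero_mem h m g := ((shiftFunctor C m).map_isZero h).eq_of_src g 0
  shift_mem Y n h m g := by
    rw [← cancel_epi ((shiftFunctorAdd C n m).hom.app Y), comp_zero]
    exact h (n + m) _
  ext_mem D hD h₁ h₃ m g := by
    obtain ⟨k, hk⟩ := Triangle.yoneda_exact₂ _ (Triangle.shift_distinguished D hD m) g (h₁ m _)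
    have hk0 : k = 0 := h₃ m k
    rw [hk, hk0]
    exact comp_zero
  retract_mem Y Z i r hir h m g := by
    rw [← Category.id_comp g, ← CategoryTheory.Functor.map_id, ← hir, Functor.map_comp,
      Category.assoc, h m (r⟦m⟧' ≫ g), comp_zero]
  coprod_mem f _ h m g := by
    rw [← cancel_epi (PreservesCoproduct.iso (shiftFunctor C m) f).inv, comp_zero]
    refine Sigma.hom_ext _ _ fun i => ?_
    rw [comp_zero]
    exact h i m _


/-- An object admitting no nonzero morphism from a compact object vanishes. -/
def CompactsDetect (C : Type u) [Category.{v} C] [HasZeroObject C] [Preadditive C]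
    [HasShift C ℤ] [∀ n : ℤ, (shiftFunctor C n).Additive] [Pretriangulated C] : Prop :=
  ∀ X : C, (∀ W : C, IsCompactObj C W → ∀ w : W ⟶ X, w = 0) → IsZero X

theorem compactsDetect_of_loc_eq_univ {E : Set C} (hE : ∀ X ∈ E, IsCompactObj C X)
    (h : Loc C E = Set.univ) : CompactsDetect C := by
  intro X hX
  have hmem : X ∈ Loc C E := h ▸ Set.mem_univ X
  have h0 := hmem _ ⟨isLocalizing_forall_shift_hom_eq_zero X,
    fun Y hY m g => hX _ (IsCompactObj.shift (hE Y hY) m) g⟩ 0 ((shiftFunctorZero C ℤ).hom.app X)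
  rw [IsZero.iff_id_eq_zero]
  exact (cancel_epi ((shiftFunctorZero C ℤ).hom.app X)).1
    ((Category.comp_id _).trans (h0.trans comp_zero.symm))

theorem IsCompactObj.exists_finset {W : C} (hW : IsCompactObj C W) {ι : Type v} [DecidableEq ι]
    {f : ι → C}
    (z : W ⟶ ∐ f) : ∃ s : Finset ι,
      z = ∑ i ∈ s, (z ≫ Sigma.π f i) ≫ Sigma.ι f i ∧ ∀ i ∉ s, z ≫ Sigma.π f i = 0 := by
  obtain ⟨s, h, hz⟩ := (isCompactObj_iff W).1 hW f z
  have hπ : ∀ j, z ≫ Sigma.π f j = if j ∈ s then h j else 0 := by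
    intro j
    rw [hz, Preadditive.sum_comp]
    split_ifs with hj
    · rw [Finset.sum_eq_single_of_mem j hj, Category.assoc, Sigma.ι_π_eq_id, Category.comp_id]
      intro i _ hij
      rw [Category.assoc, Sigma.ι_π_of_ne f hij, comp_zero]
    · refine Finset.sum_eq_zero fun i hi => ?_
      rw [Category.assoc, Sigma.ι_π_of_ne f (ne_of_mem_of_not_mem hi hj), comp_zero]
  refine ⟨s, ?_, fun i hi => by rw [hπ, if_neg hi]⟩
  conv_lhs => rw [hz]
  exact Finset.sum_congr rfl fun i hi => by rw [hπ, if_pos hi]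

section Telescope

variable {X : C} (α : X ⟶ X)

/-- The iterated composites of an endomorphism. -/
def compPow : ℕ → (X ⟶ X)
  | 0 => 𝟙 X
  | n + 1 => compPow n ≫ α

theorem comp_compPow (n : ℕ) : α ≫ compPow α n = compPow α n ≫ α := by
  induction n with
  | zero => simp [compPow]
  | succ n ih => simp only [compPow]; rw [← Category.assoc, ih]

/-- The morphism `1 - α` of the countable coproduct of copies of `X`. -/
noncomputable def telescopeMap :
    (∐ fun _ : ULift.{v} ℕ => X) ⟶ ∐ fun _ : ULift.{v} ℕ => X :=
  Sigma.desc fun n => Sigma.ι (fun _ : ULift.{v} ℕ => X) n -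
    α ≫ Sigma.ι (fun _ : ULift.{v} ℕ => X) ⟨n.down + 1⟩

theorem ι_telescopeMap (n : ℕ) :
    Sigma.ι (fun _ : ULift.{v} ℕ => X) ⟨n⟩ ≫ telescopeMap α =
      Sigma.ι (fun _ : ULift.{v} ℕ => X) ⟨n⟩ - α ≫ Sigma.ι (fun _ : ULift.{v} ℕ => X) ⟨n + 1⟩ :=
  Sigma.ι_desc _ _

theorem telescopeMap_π_zero :
    telescopeMap α ≫ Sigma.π (fun _ : ULift.{v} ℕ => X) ⟨0⟩ = Sigma.π _ ⟨0⟩ := by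
  refine Sigma.hom_ext _ _ fun ⟨n⟩ => ?_
  rw [← Category.assoc, ι_telescopeMap, Preadditive.sub_comp, Category.assoc,
    Sigma.ι_π_of_ne (fun _ : ULift.{v} ℕ => X) (b := ⟨n + 1⟩) (c := ⟨0⟩) (by simp), comp_zero,
    sub_zero]

theorem telescopeMap_π_succ (m : ℕ) :
    telescopeMap α ≫ Sigma.π (fun _ : ULift.{v} ℕ => X) ⟨m + 1⟩ =
      Sigma.π _ ⟨m + 1⟩ - Sigma.π (fun _ : ULift.{v} ℕ => X) ⟨m⟩ ≫ α := by
  refine Sigma.hom_ext _ _ fun ⟨n⟩ => ?_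
  rw [← Category.assoc, ι_telescopeMap, Preadditive.sub_comp, Preadditive.comp_sub,
    Category.assoc]
  congr 1
  obtain rfl | h := eq_or_ne n m
  · rw [Sigma.ι_π_eq_id, reassoc_of% Sigma.ι_π_eq_id (fun _ : ULift.{v} ℕ => X) ⟨n⟩]
    simp
  · rw [Sigma.ι_π_of_ne (fun _ : ULift.{v} ℕ => X) (b := ⟨n + 1⟩) (c := ⟨m + 1⟩) (by simpa using h),
      ← Category.assoc,
      Sigma.ι_π_of_ne (fun _ : ULift.{v} ℕ => X) (b := ⟨n⟩) (c := ⟨m⟩) (by simpa using h)]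
    simp

theorem eq_zero_of_comp_telescopeMap {W : C} (hW : IsCompactObj C W)
    (z : W ⟶ ∐ fun _ : ULift.{v} ℕ => X) (hz : z ≫ telescopeMap α = 0) : z = 0 := by
  have hπ : ∀ n : ℕ, z ≫ Sigma.π (fun _ : ULift.{v} ℕ => X) ⟨n⟩ = 0 := by
    intro n
    induction n with
    | zero => rw [← telescopeMap_π_zero α, ← Category.assoc, hz, zero_comp]
    | succ n ih =>
      have := telescopeMap_π_succ α n
      rw [eq_sub_iff_add_eq] at this
      rw [← this, Preadditive.comp_add, ← Category.assoc, hz, ← Category.assoc, ih]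
      simp
  obtain ⟨s, hs, -⟩ := hW.exists_finset z
  rw [hs]
  exact Finset.sum_eq_zero fun i _ => by rw [hπ i.down, zero_comp]

theorem eq_zero_of_comp_shift_telescopeMap {W : C} (hW : IsCompactObj C W)
    (z : W ⟶ (∐ fun _ : ULift.{v} ℕ => X)⟦(1 : ℤ)⟧) (hz : z ≫ (telescopeMap α)⟦(1 : ℤ)⟧' = 0) :
    z = 0 := by
  have h := eq_zero_of_comp_telescopeMap α (hW.shift (-1))
    (z⟦(-1 : ℤ)⟧' ≫ (shiftFunctorCompIsoId C 1 (-1) (by omega)).hom.app _) (by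
      rw [Category.assoc]
      have := (shiftFunctorCompIsoId C (1 : ℤ) (-1) (by omega)).hom.naturality (telescopeMap α)
      dsimp at this
      erw [← this]
      rw [← Category.assoc, ← Functor.map_comp, hz, Functor.map_zero, zero_comp])
  apply (shiftFunctor C (-1 : ℤ)).map_injective
  rw [Functor.map_zero]
  exact (cancel_mono _).1 (h.trans zero_comp.symm)

/-- The sequential homotopy colimit of an endomorphism. -/
theorem exists_hocolim : ∃ (Z : C) (c : ℕ → (X ⟶ Z)), (∀ n, α ≫ c (n + 1) = c n) ∧
    (∀ (Y : C) (k : ℕ → (X ⟶ Y)), (∀ n, α ≫ k (n + 1) = k n) → ∃ l : Z ⟶ Y, ∀ n, c n ≫ l = k n) ∧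
    (∀ W : C, IsCompactObj C W → ∀ w : W ⟶ Z, ∃ (n : ℕ) (g : W ⟶ X), g ≫ c n = w) ∧
    (∀ W : C, IsCompactObj C W → ∀ (n : ℕ) (g : W ⟶ X), g ≫ c n = 0 →
      ∃ N : ℕ, g ≫ compPow α N = 0) := by
  obtain ⟨Z, π, δ, hD⟩ := distinguished_cocone_triangle (telescopeMap α)
  have hφπ : telescopeMap α ≫ π = 0 := comp_distTriang_mor_zero₁₂ _ hD
  have hc : ∀ n : ℕ, α ≫ Sigma.ι (fun _ : ULift.{v} ℕ => X) ⟨n + 1⟩ ≫ π =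
      Sigma.ι (fun _ : ULift.{v} ℕ => X) ⟨n⟩ ≫ π := by
    intro n
    have := ι_telescopeMap α n =≫ π
    rw [Category.assoc, hφπ, comp_zero, Preadditive.sub_comp, eq_comm, sub_eq_zero,
      Category.assoc] at this
    exact this.symm
  have hpow : ∀ (k n : ℕ), compPow α k ≫ Sigma.ι (fun _ : ULift.{v} ℕ => X) ⟨n + k⟩ ≫ π =
      Sigma.ι (fun _ : ULift.{v} ℕ => X) ⟨n⟩ ≫ π := by
    intro k
    induction k with
    | zero => intro n; exact Category.id_comp _
    | succ k ih =>
      intro n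
      rw [← hc n, ← ih (n + 1), show n + 1 + k = n + (k + 1) by omega, ← Category.assoc α,
        comp_compPow]
      rfl
  refine ⟨Z, fun n => Sigma.ι (fun _ : ULift.{v} ℕ => X) ⟨n⟩ ≫ π, hc, ?_, ?_, ?_⟩
  · intro Y k hk
    obtain ⟨l, hl⟩ := exists_desc_mor₂ hD (Sigma.desc fun n : ULift.{v} ℕ => k n.down) (by
      refine Sigma.hom_ext _ _ fun ⟨n⟩ => ?_
      rw [← Category.assoc, ι_telescopeMap, Preadditive.sub_comp, Category.assoc, Sigma.ι_desc,
        Sigma.ι_desc, hk, sub_self, comp_zero])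
    refine ⟨l, fun n => ?_⟩
    rw [Category.assoc, hl, Sigma.ι_desc]
  · intro W hW w
    obtain ⟨y, rfl⟩ := exists_lift_mor₂ hD w (eq_zero_of_comp_shift_telescopeMap α hW _ (by
      rw [Category.assoc]
      exact (w ≫= comp_distTriang_mor_zero₃₁ _ hD).trans comp_zero))
    obtain ⟨s, hs, -⟩ := hW.exists_finset y
    obtain ⟨N, hN⟩ := (s.image ULift.down).bddAbove
    refine ⟨N, ∑ i ∈ s, (y ≫ Sigma.π _ i) ≫ compPow α (N - i.down), ?_⟩
    conv_rhs => rw [hs]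
    rw [Preadditive.sum_comp, Preadditive.sum_comp]
    refine Finset.sum_congr rfl fun i hi => ?_
    have hi' : i.down ≤ N := hN (Finset.mem_coe.2 (Finset.mem_image_of_mem _ hi))
    have := hpow (N - i.down) i.down
    rw [show i.down + (N - i.down) = N by omega] at this
    rw [Category.assoc, this, ← Category.assoc]
  · intro W hW n g hg
    obtain ⟨y, hy⟩ := exists_lift_mor₁ hD (g ≫ Sigma.ι (fun _ : ULift.{v} ℕ => X) ⟨n⟩)
      ((Category.assoc _ _ _).trans hg)
    have hlt : ∀ m < n, y ≫ Sigma.π (fun _ : ULift.{v} ℕ => X) ⟨m⟩ = 0 := by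
      intro m
      induction m with
      | zero =>
        intro hm
        rw [← telescopeMap_π_zero α, ← Category.assoc, hy, Category.assoc, Sigma.ι_π_of_ne _
          (by simpa using hm.ne'), comp_zero]
      | succ m ih =>
        intro hm
        have := telescopeMap_π_succ α m
        rw [eq_sub_iff_add_eq] at this
        rw [← this, Preadditive.comp_add, ← Category.assoc, hy, ← Category.assoc, ih (by omega),
          Category.assoc, Sigma.ι_π_of_ne _ (by simpa using hm.ne')]
        simp
    have hge : ∀ k, y ≫ Sigma.π (fun _ : ULift.{v} ℕ => X) ⟨n + k⟩ = g ≫ compPow α k := by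
      intro k
      induction k with
      | zero =>
        rw [add_zero]
        cases n with
        | zero =>
          rw [← telescopeMap_π_zero α, ← Category.assoc, hy, Category.assoc, Sigma.ι_π_eq_id]
          rfl
        | succ m =>
          have := telescopeMap_π_succ α m
          rw [eq_sub_iff_add_eq] at this
          rw [← this, Preadditive.comp_add, ← Category.assoc, hy, ← Category.assoc,
            hlt m (by omega), Category.assoc, Sigma.ι_π_eq_id, zero_comp, add_zero]
          rfl
      | succ k ih =>
        have := telescopeMap_π_succ α (n + k)
        rw [eq_sub_iff_add_eq] at this
        rw [← add_assoc, ← this, Preadditive.comp_add, ← Category.assoc, hy, ← Category.assoc, ih,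
          Category.assoc, Sigma.ι_π_of_ne _ (by simp; omega), comp_zero, zero_add, Category.assoc]
        rfl
    obtain ⟨s, -, hs⟩ := hW.exists_finset y
    obtain ⟨M, hM⟩ := (s.image ULift.down).bddAbove
    refine ⟨M + 1, ?_⟩
    rw [← hge, hs]
    intro hmem
    have : n + (M + 1) ≤ M := hM (Finset.mem_coe.2 (Finset.mem_image_of_mem _ hmem))
    omega

end Telescope

section Phantom

theorem CompactsDetect.isIso (hC : CompactsDetect C) {X Y : C} (f : X ⟶ Y)
    (hf : ∀ W : C, IsCompactObj C W → Function.Bijective fun w : W ⟶ X => w ≫ f) : IsIso f := by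
  obtain ⟨Z, g, h, hD⟩ := distinguished_cocone_triangle f
  refine (Triangle.isZero₃_iff_isIso₁ _ hD).1 (hC Z fun W hW w => ?_)
  have hgh : g ≫ h = 0 := comp_distTriang_mor_zero₂₃ _ hD
  have hfg : f ≫ g = 0 := comp_distTriang_mor_zero₁₂ _ hD
  have hhf : h ≫ f⟦(1 : ℤ)⟧' = 0 := comp_distTriang_mor_zero₃₁ _ hD
  have hwh : w ≫ h = 0 := by
    let e := shiftFunctorCompIsoId C (1 : ℤ) (-1) (by omega)
    have hz : ((w ≫ h)⟦(-1 : ℤ)⟧' ≫ e.hom.app X) ≫ f = 0 := by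
      have := e.hom.naturality f
      dsimp at this
      rw [Category.assoc]
      erw [← this]
      rw [← Category.assoc, ← Functor.map_comp, Category.assoc, hhf, comp_zero, Functor.map_zero,
        zero_comp]
    apply (shiftFunctor C (-1 : ℤ)).map_injective
    rw [Functor.map_zero, ← cancel_mono (e.hom.app X)]
    exact (hf _ (hW.shift (-1))).1 (hz.trans (by simp))
  obtain ⟨k, rfl⟩ := exists_lift_mor₂ hD w hwh
  obtain ⟨l, rfl⟩ := (hf W hW).2 k
  simp [hfg]

/-- A phantom idempotent vanishes. -/
theorem CompactsDetect.idem_eq_zero (hC : CompactsDetect C) {X : C} {e : X ⟶ X} (he : e ≫ e = e)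
    (h : ∀ W : C, IsCompactObj C W → ∀ w : W ⟶ X, w ≫ e = 0) : e = 0 := by
  obtain ⟨Z, c, hc, hdesc, hlift, -⟩ := exists_hocolim e
  have hZ : IsZero Z := hC Z fun W hW w => by
    obtain ⟨n, g, rfl⟩ := hlift W hW w
    rw [← hc n, ← Category.assoc, h W hW, zero_comp]
  obtain ⟨l, hl⟩ := hdesc X (fun _ => e) fun _ => he
  rw [← hl 0, hZ.eq_of_src l 0, comp_zero]

/-- A phantom morphism into a regular object vanishes. -/
theorem IsRegularObj.eq_zero_of_phantom {D : C} (hD : IsRegularObj D) (hC : CompactsDetect C)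
    {X : C} (f : X ⟶ D) (h : ∀ W : C, IsCompactObj C W → ∀ w : W ⟶ X, w ≫ f = 0) : f = 0 := by
  obtain ⟨k, hk⟩ := hD f
  have : k ≫ f = 0 := hC.idem_eq_zero (by rw [Category.assoc, hk]) fun W hW w => by
    rw [← Category.assoc, h W hW]
  rw [← hk, this, comp_zero]

/-- Idempotents of regular objects split. -/
theorem IsRegularObj.exists_split {D : C} (hD : IsRegularObj D) (hC : CompactsDetect C)
    {e : D ⟶ D} (he : e ≫ e = e) : ∃ (Z : C) (i : Z ⟶ D) (r : D ⟶ Z), i ≫ r = 𝟙 Z ∧ r ≫ i = e := by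
  obtain ⟨Z, c, hc, hdesc, hlift, -⟩ := exists_hocolim e
  have hec : ∀ n, e ≫ c n = c n := fun n => by rw [← hc n, ← Category.assoc, he]
  have hconst : ∀ n, c n = c 0 := fun n => by
    induction n with
    | zero => rfl
    | succ n ih => rw [← hec (n + 1), hc n, ih]
  obtain ⟨l, hl⟩ := hdesc D (fun _ => e) fun _ => he
  have hphantom : ∀ {Y : C} (θ : Z ⟶ Y), c 0 ≫ θ = 0 → ∀ W : C, IsCompactObj C W →
      ∀ w : W ⟶ Z, w ≫ θ = 0 := by
    intro Y θ hθ W hW w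
    obtain ⟨n, g, rfl⟩ := hlift W hW w
    rw [hconst, Category.assoc, hθ, comp_zero]
  have hle : l ≫ e = l := by
    rw [← sub_eq_zero]
    exact hD.eq_zero_of_phantom hC _ (hphantom _ (by
      rw [Preadditive.comp_sub, ← Category.assoc, hl, he, sub_self]))
  refine ⟨Z, l, c 0, ?_, hl 0⟩
  have hidem : (l ≫ c 0) ≫ (l ≫ c 0) = l ≫ c 0 := by
    rw [Category.assoc, ← Category.assoc (c 0), hl, hec]
  rw [eq_comm, ← sub_eq_zero]
  refine hC.idem_eq_zero ?_ (hphantom _ ?_)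
  · rw [Preadditive.sub_comp, Preadditive.comp_sub, Preadditive.comp_sub, hidem]
    simp
  · rw [Preadditive.comp_sub, ← Category.assoc, hl, hec]
    simp

/-- A morphism from a compact object on which `a` vanishes while no power of `c` does yields a
nonzero regular object on which `a` vanishes and `c` is invertible, provided `c - a` is regular. -/
theorem exists_regularObj (hC : CompactsDetect C) {a c : End (𝟭 C)} (hd : IsRegularElement (c - a))
    {W X : C} (hW : IsCompactObj C W) (w : W ⟶ X) (hwa : w ≫ cen a X = 0)
    (hwc : ∀ N : ℕ, w ≫ cen (c ^ N) X ≠ 0) :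
    ∃ D : C, ¬ IsZero D ∧ cen a D = 0 ∧ IsIso (cen c D) ∧ IsRegularObj D := by
  obtain ⟨h, hh⟩ := hd w
  rw [cen_sub, Preadditive.comp_sub, hwa, sub_zero] at hh
  let α : W ⟶ W := w ≫ h
  have hαw : α ≫ w = w ≫ cen c X := (Category.assoc _ _ _).trans hh.symm
  have hαα : α ≫ α = cen c W ≫ α := by
    change α ≫ w ≫ h = cen c W ≫ w ≫ h
    rw [← Category.assoc, hαw, comp_cen, Category.assoc]
  have haα : cen a W ≫ α = 0 := by
    change cen a W ≫ w ≫ h = 0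
    rw [← Category.assoc, ← comp_cen, hwa, zero_comp]
  have hpow : ∀ N, compPow α N ≫ w = w ≫ cen (c ^ N) X := by
    intro N
    induction N with
    | zero => rw [pow_zero, cen_one, compPow, Category.id_comp, Category.comp_id]
    | succ N ih =>
      rw [compPow, Category.assoc, hαw, ← Category.assoc, ih, pow_succ, cen_mul, Category.assoc]
  obtain ⟨D, q, hq, -, hlift, hker⟩ := exists_hocolim α
  have hq' : ∀ n, α ≫ q n = cen c W ≫ q n := fun n => by
    rw [← hq n, ← Category.assoc, hαα, Category.assoc]
  have hqa : ∀ n, q n ≫ cen a D = 0 := fun n => by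
    rw [comp_cen, ← hq n, ← Category.assoc, haα, zero_comp]
  have ha : ∀ W' : C, IsCompactObj C W' → ∀ v : W' ⟶ D, v ≫ cen a D = 0 := by
    intro W' hW' v
    obtain ⟨n, g, rfl⟩ := hlift W' hW' v
    rw [Category.assoc, hqa, comp_zero]
  have hda : ∀ W' : C, IsCompactObj C W' → ∀ v : W' ⟶ D, v ≫ cen (c - a) D = v ≫ cen c D := by
    intro W' hW' v
    rw [cen_sub, Preadditive.comp_sub, ha W' hW', sub_zero]
  have hqc : ∀ n, q (n + 1) ≫ cen c D = q n := fun n => by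
    rw [comp_cen, ← hq', hq]
  have hd' : IsIso (cen (c - a) D) := by
    refine hC.isIso _ fun W' hW' => ⟨?_, ?_⟩
    · refine (injective_iff_map_eq_zero (Preadditive.rightComp W' (cen (c - a) D))).2 fun v hv => ?_
      replace hv : v ≫ cen (c - a) D = 0 := hv
      rw [hda W' hW'] at hv
      obtain ⟨n, g, rfl⟩ := hlift W' hW' v
      have h0 : (g ≫ α) ≫ q n = 0 := by
        rw [Category.assoc, hq', ← comp_cen, ← Category.assoc, hv]
      obtain ⟨N, hN⟩ := hker W' hW' n _ h0
      have hq_pow : ∀ k m, compPow α k ≫ q (m + k) = q m := by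
        intro k
        induction k with
        | zero => intro m; simp [compPow]
        | succ k ih =>
          intro m
          rw [compPow, Category.assoc, ← add_assoc, hq, ih]
      rw [← hq_pow (N + 1) n, compPow, ← comp_compPow, ← Category.assoc, ← Category.assoc, hN,
        zero_comp]
    · intro v
      obtain ⟨n, g, rfl⟩ := hlift W' hW' v
      refine ⟨g ≫ q (n + 1), ?_⟩
      change (g ≫ q (n + 1)) ≫ cen (c - a) D = _
      rw [hda W' hW', Category.assoc, hqc]
  have hreg := hd.isRegularObj hd'
  have ha0 : cen a D = 0 := hreg.eq_zero_of_phantom hC _ ha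
  refine ⟨D, fun hD => ?_, ha0, ?_, hreg⟩
  · obtain ⟨N, hN⟩ := hker W hW 0 (𝟙 W) (hD.eq_of_tgt _ _)
    rw [Category.id_comp] at hN
    exact hwc N (by rw [← hpow, hN, zero_comp])
  · rwa [cen_sub, ha0, sub_zero] at hd'

end Phantom

end

section
variable {C : Type u} [Category.{v} C] [HasZeroObject C] [Preadditive C]
  [HasShift C ℤ] [∀ n : ℤ, (shiftFunctor C n).Additive] [Pretriangulated C]

theorem cen_eq_zero_of_retract (a : End (𝟭 C)) {X Y : C} (i : X ⟶ Y) (r : Y ⟶ X) (hir : i ≫ r = 𝟙 X)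
    (h : cen a Y = 0) : cen a X = 0 := by
  rw [← Category.comp_id (cen a X), ← hir, ← Category.assoc, ← comp_cen, h, comp_zero, zero_comp]

theorem isIso_cen_of_retract (a : End (𝟭 C)) {X Y : C} (i : X ⟶ Y) (r : Y ⟶ X) (hir : i ≫ r = 𝟙 X)
    (h : IsIso (cen a Y)) : IsIso (cen a X) := by
  refine ⟨i ≫ inv (cen a Y) ≫ r, ?_, ?_⟩
  · rw [← Category.assoc, ← comp_cen, Category.assoc, IsIso.hom_inv_id_assoc, hir]
  · rw [Category.assoc, Category.assoc, comp_cen, IsIso.inv_hom_id_assoc, hir]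

theorem map_cen_shiftEnd_pow (a : End (𝟭 C)) (N : ℕ) (X : C) :
    (cen (shiftEnd a ^ N) X)⟦(1 : ℤ)⟧' = cen (a ^ N) (X⟦(1 : ℤ)⟧) := by
  induction N with
  | zero => simp only [pow_zero, cen_one, CategoryTheory.Functor.map_id]
  | succ N ih => rw [pow_succ, pow_succ, cen_mul, cen_mul, Functor.map_comp, ih, map_cen_shiftEnd]

theorem isIso_cen_pow (a : End (𝟭 C)) {X : C} (h : IsIso (cen a X)) (n : ℕ) :
    IsIso (cen (a ^ n) X) := by
  induction n with
  | zero => rw [pow_zero, cen_one]; infer_instance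
  | succ n ih => rw [pow_succ, cen_mul]; infer_instance

theorem isColocalizing_isZero : IsColocalizing C {X : C | IsZero X} where
  iso_mem e h := IsZero.of_iso h e.symm
  zero_mem h := h
  shift_mem X n h := (shiftFunctor C n).map_isZero h
  ext_mem D hD h₁ h₃ := Triangle.isZero₂_of_isZero₁₃ D hD h₁ h₃
  retract_mem X Y i r hir h := by
    rw [Set.mem_ofPred_eq, IsZero.iff_id_eq_zero, ← hir, h.eq_of_tgt i 0, zero_comp]
  prod_mem f _ h := by
    rw [Set.mem_ofPred_eq, IsZero.iff_id_eq_zero]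
    exact Pi.hom_ext _ _ fun i => (h i).eq_of_tgt _ _

theorem isColocalizing_forall_shift_hom_eq_zero (X : C) :
    IsColocalizing C {Y : C | ∀ (m : ℤ) (g : X⟦m⟧ ⟶ Y), g = 0} where
  iso_mem e h m g := by
    rw [← cancel_mono e.inv, zero_comp]
    exact h m _
  zero_mem h m g := h.eq_of_tgt g 0
  shift_mem Y n h m g := by
    apply (shiftFunctor C (-n)).map_injective
    rw [Functor.map_zero, ← cancel_epi ((shiftFunctorAdd C m (-n)).hom.app X),
      ← cancel_mono ((shiftFunctorCompIsoId C n (-n) (by omega)).hom.app Y), comp_zero, zero_comp]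
    exact h _ _
  ext_mem D hD h₁ h₃ m g := by
    obtain ⟨k, rfl⟩ := Triangle.coyoneda_exact₂ D hD g (h₃ m _)
    rw [h₁ m k, zero_comp]
  retract_mem Y Z i r hir h m g := by
    rw [← Category.comp_id g, ← hir, ← Category.assoc, h m (g ≫ i), zero_comp]
  prod_mem f _ h m g := by
    refine Pi.hom_ext _ _ fun i => ?_
    rw [zero_comp]
    exact h i m _

namespace BIKPackage

section Completion

variable {P : Type} [PartialOrder P] (B : BIKPackage C P)
  {V : Set P} (hV : SpecializationClosed V)

theorem gam_map_zero (X Y : C) : (B.gam V hV).map (0 : X ⟶ Y) = 0 :=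
  have := (B.gam_adj V hV).isLeftAdjoint
  Functor.map_zero _ _ _

/-- The completion map `X ⟶ Λ^V X`. -/
def completionMap (X : C) : X ⟶ (B.lam V hV).obj X :=
  (B.gam_adj V hV).homEquiv X X (B.γ hV X)

theorem isIso_γ_gam (X : C) : IsIso (B.γ hV ((B.gam V hV).obj X)) :=
  (B.isIso_γ_iff hV).2 (B.gam_acyclic V hV X)

theorem isZero_lam_of_γ_eq_zero {U : C} (h : B.γ hV U = 0) : IsZero ((B.lam V hV).obj U) := by
  have hk : ∀ (X : C) (k : (B.gam V hV).obj X ⟶ U), k = 0 := fun X k => by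
    have := B.isIso_γ_gam hV X
    rw [← cancel_epi (B.γ hV _), ← γ_naturality, h, comp_zero, comp_zero]
  rw [IsZero.iff_id_eq_zero]
  apply ((B.gam_adj V hV).homEquiv _ _).symm.injective
  rw [hk _ (((B.gam_adj V hV).homEquiv _ _).symm (𝟙 _)),
    hk _ (((B.gam_adj V hV).homEquiv _ _).symm 0)]

theorem γ_comp_eq_zero {Z U : C} {k : Z ⟶ U} (h : k ≫ B.completionMap hV U = 0) :
    B.γ hV Z ≫ k = 0 := by
  have h₁ : ((B.gam_adj V hV).homEquiv Z U).symm (k ≫ B.completionMap hV U) =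
      (B.gam V hV).map k ≫ B.γ hV U := by
    rw [Adjunction.homEquiv_naturality_left_symm, completionMap, Equiv.symm_apply_apply]
  rw [← γ_naturality, ← h₁, h, Adjunction.homEquiv_counit, gam_map_zero, zero_comp]

theorem isZero_lam_of_completionMap_eq_zero {U : C} (h : B.completionMap hV U = 0) :
    IsZero ((B.lam V hV).obj U) := by
  refine B.isZero_lam_of_γ_eq_zero hV ?_
  rw [← B.γ_comp_eq_zero hV (k := 𝟙 U) (by rw [h, comp_zero]), Category.comp_id]

theorem isZero_lam_of_γ_comp_completionMap_eq_zero {U : C}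
    (h : B.γ hV U ≫ B.completionMap hV U = 0) : IsZero ((B.lam V hV).obj U) := by
  refine B.isZero_lam_of_γ_eq_zero hV ?_
  have := B.isIso_γ_gam hV U
  rw [← cancel_epi (B.γ hV _), comp_zero, B.γ_comp_eq_zero hV h]

theorem hom_vee_eq_zero {X : C} (hX : IsZero ((B.loc V hV).obj X)) {Y : C}
    (f : X ⟶ (B.vee V hV).obj Y) : f = 0 :=
  ((B.loc_adj V hV).homEquiv X Y).symm.injective (hX.eq_of_src _ _)

end Completion

section KerChar

variable [HasCoproducts.{v} C] {S : Type} [CommRing S] {φ : S →+* End (𝟭 C)}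
  {B : BIKPackage C (Spec0 S)}

theorem KerChar.isZero_loc_of_cen_eq_zero (hφ : B.KerChar φ) {V : Set (Spec0 S)}
    (hV : SpecializationClosed V) {s : S} (hs : ∀ q ∉ V, s ∉ q.1) {X : C} (h : cen (φ s) X = 0) :
    IsZero ((B.loc V hV).obj X) :=
  (hφ V hV X).2 fun q hq _ _ w => ⟨s, hs q hq, (w ≫= h).trans comp_zero⟩

/-- A morphism from a compact object to `Γ_V X` is killed by a power of any element that belongs
to every prime in `V`. -/
theorem KerChar.exists_pow_comp_eq_zero (hφ : B.KerChar φ) {V : Set (Spec0 S)}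
    {hV : SpecializationClosed V} {s : S} (hs : ∀ q ∈ V, s ∈ q.1) {X : C}
    (hX : IsZero ((B.loc V hV).obj X)) {W : C} (hW : IsCompactObj C W) (w : W ⟶ X) :
    ∃ n : ℕ, w ≫ cen (φ s ^ n) X = 0 := by
  let J : Ideal S :=
    { carrier := {r | w ≫ cen (φ r) X = 0}
      add_mem' := fun {r t} hr ht => by
        change w ≫ cen (φ (r + t)) X = 0
        rw [map_add]
        change w ≫ (cen (φ r) X + cen (φ t) X) = 0
        rw [Preadditive.comp_add, hr, ht, add_zero]
      zero_mem' := by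
        change w ≫ cen (φ 0) X = 0
        rw [map_zero, cen_zero, comp_zero]
      smul_mem' := fun r t ht => by
        change w ≫ cen (φ (r * t)) X = 0
        rw [mul_comm, map_mul, cen_mul, ← Category.assoc, ht, zero_comp] }
  have hrad : s ∈ J.radical := by
    rw [Ideal.radical_eq_sInf, Ideal.mem_sInf]
    rintro q ⟨hJq, hq⟩
    by_contra hsq
    obtain ⟨r, hr, hr'⟩ := (hφ V hV X).1 hX ⟨q, hq⟩ (fun hqV => hsq (hs _ hqV)) W hW w
    exact hr (hJq hr')
  obtain ⟨n, hn⟩ := hrad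
  refine ⟨n, ?_⟩
  rw [← map_pow]
  exact hn

/-- A regular object all of whose shifts are of the form `Λ^p V_p X` cannot have a shift on which
an element acts as zero and another one on which it acts invertibly. -/
theorem KerChar.false_of_mem_essImageSet (hφ : B.KerChar φ) (hC : CompactsDetect C)
    {p : Spec0 S} {D : C} (hD0 : ¬ IsZero D) (hD : IsRegularObj D)
    (hp : ∀ k : ℤ, D⟦k⟧ ∈ essImageSet C (B.lv p)) {s : S} {i j : ℤ}
    (hi : cen (φ s) (D⟦i⟧) = 0) (hj : IsIso (cen (φ s) (D⟦j⟧))) : False := by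
  have hshift : ∀ k : ℤ, ∃ U Y : C, U = (B.vee _ (specializationClosed_notDown p)).obj Y ∧
      Nonempty ((B.lam _ (specializationClosed_up p)).obj U ≅ D⟦k⟧) := fun k =>
    let ⟨Y, hY⟩ := hp k
    ⟨_, Y, rfl, hY⟩
  have hne : ∀ k : ℤ, ¬ IsZero (D⟦k⟧) := fun k hk =>
    hD0 (((shiftFunctor C (-k)).map_isZero hk).of_iso
      ((shiftFunctorCompIsoId C k (-k) (by omega)).symm.app D))
  by_cases hs : s ∈ p.1
  · obtain ⟨U, -, -, ⟨e⟩⟩ := hshift j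
    refine hne j (IsZero.of_iso (B.isZero_lam_of_γ_comp_completionMap_eq_zero
      (specializationClosed_up p) ?_) e.symm)
    have hreg := (hD.shift j).of_retract e.hom e.inv e.hom_inv_id
    have hiso := isIso_cen_of_retract _ e.hom e.inv e.hom_inv_id hj
    refine hreg.eq_zero_of_phantom hC _ fun W hW w => ?_
    obtain ⟨n, hn⟩ := hφ.exists_pow_comp_eq_zero (V := {q | p ≤ q}) (fun q hq => hq hs)
      (B.gam_acyclic _ (specializationClosed_up p) U) hW w
    have := isIso_cen_pow _ hiso n
    rw [← cancel_mono (cen (φ s ^ n) _), zero_comp, Category.assoc, comp_cen, ← Category.assoc,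
      hn, zero_comp]
  · obtain ⟨U, Y, rfl, ⟨e⟩⟩ := hshift i
    refine hne i (IsZero.of_iso (B.isZero_lam_of_completionMap_eq_zero
      (specializationClosed_up p) ?_) e.symm)
    have hreg := (hD.shift i).of_retract e.hom e.inv e.hom_inv_id
    have hzero := cen_eq_zero_of_retract _ e.hom e.inv e.hom_inv_id hi
    obtain ⟨h, hh⟩ := hreg (B.completionMap (specializationClosed_up p) _)
    have h0 : h = 0 := B.hom_vee_eq_zero (specializationClosed_notDown p)
      (hφ.isZero_loc_of_cen_eq_zero _ (fun q hq hsq => hs ((not_not.1 hq : q ≤ p) hsq)) hzero) h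
    rw [← hh, h0, zero_comp, comp_zero]

theorem Costratified.false_of_isRegularObj (hB : B.Costratified) (hφ : B.KerChar φ)
    (hC : CompactsDetect C) {D : C} (hD0 : ¬ IsZero D) (hD : IsRegularObj D) {s : S} {i j : ℤ}
    (hi : cen (φ s) (D⟦i⟧) = 0) (hj : IsIso (cen (φ s) (D⟦j⟧))) : False := by
  obtain ⟨p, hp⟩ : ∃ p, ¬ IsZero ((B.lv p).obj D) := by
    by_contra! h
    have hmem : D ∈ Coloc C (Set.range fun p => (B.lv p).obj D) := by
      rw [← hB.1 D]
      exact fun S hS => hS.2 rfl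
    exact hD0 (hmem _ ⟨isColocalizing_isZero, by rintro _ ⟨p, rfl⟩; exact h p⟩)
  have hmem : (B.lv p).obj D ∈ Coloc C {D} := by
    rw [hB.1 D]
    exact fun S hS => hS.2 ⟨p, rfl⟩
  obtain ⟨m, f, hf⟩ : ∃ (m : ℤ) (f : ((B.lv p).obj D)⟦m⟧ ⟶ D), f ≠ 0 := by
    by_contra! h
    have h0 := hmem _ ⟨isColocalizing_forall_shift_hom_eq_zero ((B.lv p).obj D),
      Set.singleton_subset_iff.2 h⟩ 0 ((shiftFunctorZero C ℤ).hom.app _)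
    refine hp ?_
    rw [IsZero.iff_id_eq_zero]
    exact (cancel_epi ((shiftFunctorZero C ℤ).hom.app _)).1
      ((Category.comp_id _).trans (h0.trans comp_zero.symm))
  have himg : IsColocalizing C (essImageSet C (B.lv p)) := by
    rcases hB.2 p with h | h
    · exact (hp (h _ ⟨D, ⟨Iso.refl _⟩⟩)).elim
    · exact h.1
  obtain ⟨h, hh⟩ := hD f
  obtain ⟨Z, ι, r, hr, he⟩ := hD.exists_split hC (e := h ≫ f) (by rw [Category.assoc, hh])
  refine hφ.false_of_mem_essImageSet hC (p := p) (D := Z) ?_ (hD.of_retract ι r hr) ?_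
    (cen_eq_zero_of_retract _ (ι⟦i⟧') (r⟦i⟧') ?_ hi) (isIso_cen_of_retract _ (ι⟦j⟧') (r⟦j⟧') ?_ hj)
  · intro hZ
    rw [hZ.eq_of_tgt r 0, zero_comp] at he
    rw [← he, comp_zero] at hh
    exact hf hh.symm
  · intro k
    refine himg.shift_mem _ _ (himg.retract_mem Z _ (ι ≫ h) (f ≫ r) ?_
      (himg.shift_mem _ m ⟨D, ⟨Iso.refl _⟩⟩))
    rw [Category.assoc, ← Category.assoc h, ← he, Category.assoc, hr, Category.comp_id, hr]
  · rw [← Functor.map_comp, hr, CategoryTheory.Functor.map_id]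
  · rw [← Functor.map_comp, hr, CategoryTheory.Functor.map_id]

theorem Costratified.isZero_loc_shift_one (hB : B.Costratified) (hφ : B.KerChar φ)
    (hC : CompactsDetect C) {V : Set (Spec0 S)} (hV : SpecializationClosed V) {X : C} :
    IsZero ((B.loc V hV).obj (X⟦(1 : ℤ)⟧)) ↔ IsZero ((B.loc V hV).obj X) := by
  have hzero : ∀ {a : End (𝟭 C)} {D : C}, cen a D = 0 → cen a (D⟦(0 : ℤ)⟧) = 0 := fun {_ D} h =>
    cen_eq_zero_of_retract _ ((shiftFunctorZero C ℤ).hom.app D) ((shiftFunctorZero C ℤ).inv.app D)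
      (by simp) h
  have hiso : ∀ {a : End (𝟭 C)} {D : C}, IsIso (cen a D) → IsIso (cen a (D⟦(0 : ℤ)⟧)) :=
    fun {_ D} h => isIso_cen_of_retract _ ((shiftFunctorZero C ℤ).hom.app D)
      ((shiftFunctorZero C ℤ).inv.app D) (by simp) h
  have hpow : ∀ {q : Spec0 S} {s : S}, s ∉ q.1 → ∀ N : ℕ, s ^ N ∉ q.1 := fun {q _} hs N h =>
    hs (q.2.mem_of_pow_mem N h)
  constructor
  · intro hX
    refine (hφ V hV X).2 fun q hq W hW w => ?_
    obtain ⟨s, hs, hws⟩ := (hφ V hV _).1 hX q hq _ (hW.shift 1) (w⟦(1 : ℤ)⟧')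
    by_contra! hne
    obtain ⟨D, hD0, hDa, hDc, hD⟩ := exists_regularObj hC (a := shiftEnd (φ s)) (c := φ s)
      (by simpa using (isRegularElement_shiftEnd_sub (φ s)).neg) hW w
      ((shiftFunctor C (1 : ℤ)).map_injective (by
        rw [Functor.map_comp, map_cen_shiftEnd, Functor.map_zero]; exact hws))
      (fun N => by rw [← map_pow]; exact hne _ (hpow hs N))
    refine hB.false_of_isRegularObj hφ hC hD0 hD (s := s) (i := 1) (j := 0) ?_ (hiso hDc)
    rw [← map_cen_shiftEnd, hDa, Functor.map_zero]
  · intro hX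
    refine (hφ V hV _).2 fun q hq W hW w => ?_
    let e := shiftFunctorCompIsoId C (-1 : ℤ) 1 (by omega)
    obtain ⟨w', hw'⟩ := (shiftFunctor C (1 : ℤ)).map_surjective (e.hom.app W ≫ w)
    obtain ⟨s, hs, hws⟩ := (hφ V hV X).1 hX q hq _ (hW.shift (-1)) w'
    by_contra! hne
    obtain ⟨D, hD0, hDa, hDc, hD⟩ := exists_regularObj hC (a := φ s) (c := shiftEnd (φ s))
      (isRegularElement_shiftEnd_sub (φ s)) (hW.shift (-1)) w' hws (fun N hN => by
        refine hne _ (hpow hs N) ?_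
        have h := congrArg (fun k => k⟦(1 : ℤ)⟧') hN
        rw [Functor.map_comp, hw', map_cen_shiftEnd_pow, Functor.map_zero, ← map_pow,
          Category.assoc] at h
        exact (cancel_epi (e.hom.app W)).1 (h.trans comp_zero.symm))
    refine hB.false_of_isRegularObj hφ hC hD0 hD (s := s) (i := 0) (j := 1) (hzero hDa) ?_
    rw [← map_cen_shiftEnd]
    infer_instance

theorem Costratified.shiftStable (hB : B.Costratified) (hφ : B.KerChar φ)
    (hC : CompactsDetect C) : B.ShiftStable := by
  intro V hV X hX n
  have hsucc : ∀ m : ℤ, IsZero ((B.loc V hV).obj (X⟦m + 1⟧)) ↔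
      IsZero ((B.loc V hV).obj (X⟦m⟧)) := fun m => by
    rw [← hB.isZero_loc_shift_one hφ hC hV (X := X⟦m⟧)]
    exact ⟨B.isZero_loc_of_iso hV ((shiftFunctorAdd C m 1).app X),
      B.isZero_loc_of_iso hV ((shiftFunctorAdd C m 1).app X).symm⟩
  induction n using Int.induction_on with
  | zero => exact B.isZero_loc_of_iso hV ((shiftFunctorZero C ℤ).symm.app X) hX
  | succ n ih => exact (hsucc _).2 ih
  | pred n ih => exact (hsucc _).1 (by simpa using ih)

end KerChar

end BIKPackage

end

section
variable {C : Type u} [Category.{v} C] [HasZeroObject C] [Preadditive C]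
  [HasShift C ℤ] [∀ n : ℤ, (shiftFunctor C n).Additive] [Pretriangulated C]
  [HasCoproducts.{v} C] {R : Type} [Ring R] {G : GradedCommNoethRing R} {A : RAction C G}

theorem CharBIKPackage0.kerChar (B : CharBIKPackage0 C G.degZeroSubring (A.restrictDegZero C)) :
    B.toBIKPackage.KerChar A.degZeroCenter := by
  intro V hV X
  rw [B.ker_char]
  exact forall₂_congr fun q _ => forall_shift_iff A.degZeroCenter q

theorem RAction.comp_act_eq_zero_iff {W X : C} (n : ℤ) (g : W ⟶ X⟦n⟧) (s : G.degZeroSubring) :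
    g ≫ (A.restrictDegZero C X s)⟦n⟧' = 0 ↔ g ≫ (A.act X 0 ⟨s.1, s.2⟩)⟦n⟧' = 0 := by
  rw [restrictDegZero, Functor.map_comp, ← Category.assoc]
  exact ⟨fun h => (cancel_mono (((shiftFunctorZero C ℤ).hom.app X)⟦n⟧')).1 (h.trans zero_comp.symm),
    fun h => by rw [h, zero_comp]⟩

theorem CharBIKPackage.kerChar_reindex (B : CharBIKPackage C G A)
    (hnil : ∀ n : ℤ, n ≠ 0 → ∀ a ∈ G.deg n, IsNilpotent a) :
    (B.toBIKPackage.reindex (G.contractIso hnil)).KerChar A.degZeroCenter := by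
  intro V hV X
  refine (B.ker_char _ _ X).trans ?_
  rw [(G.contractIso hnil).surjective.forall]
  refine forall₂_congr fun p _ => (forall₄_congr fun W _ n g => ?_).trans
    (forall_shift_iff A.degZeroCenter _)
  constructor
  · rintro ⟨d, s, hs, hgs⟩
    obtain rfl : d = 0 := by
      by_contra hd
      exact hs (G.mem_of_deg_ne_zero hnil p hd s.2)
    exact ⟨⟨s.1, s.2⟩, fun h => hs ((G.mem_contractIso hnil p _).1 h),
      (RAction.comp_act_eq_zero_iff n g _).2 hgs⟩
  · rintro ⟨s, hs, hgs⟩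
    exact ⟨0, ⟨s.1, s.2⟩, fun h => hs ((G.mem_contractIso hnil p s).2 h),
      (RAction.comp_act_eq_zero_iff n g s).1 hgs⟩

theorem BIKPackage.stratified_iff_of_kerChar {S : Type} [CommRing S] {φ : S →+* End (𝟭 C)}
    {B B' : BIKPackage C (Spec0 S)} (hB : B.KerChar φ) (hB' : B'.KerChar φ) :
    B.Stratified ↔ B'.Stratified := by
  suffices H : ∀ {B B' : BIKPackage C (Spec0 S)}, B.KerChar φ → B'.KerChar φ →
      B.Stratified → B'.Stratified from ⟨H hB hB', H hB' hB⟩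
  intro B B' hB hB' h
  have hker : ∀ V hV (X : C), IsZero ((B.loc V hV).obj X) ↔ IsZero ((B'.loc V hV).obj X) :=
    fun V hV X => (hB V hV X).trans (hB' V hV X).symm
  have hs := h.shiftStable hB.mono
  exact h.of_iso fun p => nonempty_gl_iso hs
    (fun V hV X hX n => (hker V hV _).1 (hs V hV X ((hker V hV X).2 hX) n)) hker p

theorem BIKPackage.costratified_iff_of_kerChar (hC : CompactsDetect C) {S : Type} [CommRing S]
    {φ : S →+* End (𝟭 C)} {B B' : BIKPackage C (Spec0 S)} (hB : B.KerChar φ)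
    (hB' : B'.KerChar φ) : B.Costratified ↔ B'.Costratified := by
  suffices H : ∀ {B B' : BIKPackage C (Spec0 S)}, B.KerChar φ → B'.KerChar φ →
      B.Costratified → B'.Costratified from ⟨H hB hB', H hB' hB⟩
  intro B B' hB hB' h
  have hker : ∀ V hV (X : C), IsZero ((B.loc V hV).obj X) ↔ IsZero ((B'.loc V hV).obj X) :=
    fun V hV X => (hB V hV X).trans (hB' V hV X).symm
  have hs := h.shiftStable hB hC
  exact h.of_iso fun p => nonempty_lv_iso hs
    (fun V hV X hX n => (hker V hV _).1 (hs V hV X ((hker V hV X).2 hX) n)) hker p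

end

/-- Let `R` be a graded-commutative noetherian ring with degree-zero
subring `R^0`, such that every homogeneous element of nonzero degree is nilpotent.
Let `T` be an (compactly generated) `R`-linear triangulated category, regarded also as
`R^0`-linear by restriction.  Then `T` is stratified (resp. costratified) by `R` iff
it is stratified (resp. costratified) by `R^0`. -/
theorem stratified_iff_stratified_degZero
    (R : Type) [Ring R] (G : GradedCommNoethRing R)
    (T : Type u) [Category.{v} T] [HasZeroObject T] [Preadditive T]
    [HasShift T ℤ] [∀ n : ℤ, (shiftFunctor T n).Additive] [Pretriangulated T]
    [HasCoproducts.{v} T] [HasProducts.{v} T]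
    -- `T` is compactly generated:
    (Gens : Set T) (hGens : ∀ X ∈ Gens, IsCompactObj T X) (hgen : Loc T Gens = Set.univ)
    -- the `R`-action on `T`:
    (A : RAction T G)
    -- every homogeneous element of nonzero degree is nilpotent:
    (hnil : ∀ (n : ℤ), n ≠ 0 → ∀ a ∈ G.deg n, IsNilpotent a)
    -- the BIK functors for the `R`-action and for the restricted `R^0`-action:
    (BR : CharBIKPackage T G A)
    (B0 : CharBIKPackage0 T G.degZeroSubring A.restrictDegZero) :
    (BR.toBIKPackage.Stratified ↔ B0.toBIKPackage.Stratified) ∧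
    (BR.toBIKPackage.Costratified ↔ B0.toBIKPackage.Costratified) := by
  rw [← BR.toBIKPackage.reindex_stratified (G.contractIso hnil),
    ← BR.toBIKPackage.reindex_costratified (G.contractIso hnil)]
  exact ⟨BIKPackage.stratified_iff_of_kerChar (BR.kerChar_reindex hnil) B0.kerChar,
    BIKPackage.costratified_iff_of_kerChar (compactsDetect_of_loc_eq_univ hGens hgen)
      (BR.kerChar_reindex hnil) B0.kerChar⟩

end Paper
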